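/- arXiv:0909.5451 — 2 statements merged into one kernel-verified Lean document; each statement's English description precedes it below -/
import Mathlib

section
/- For every p ≥ 2 there exists a constant C_p > 0, independent of R ≥ 1, such that for every R ≥ 1 and every function f₂ on the square K_R = (0,R)² whose modulus |f₂| extends to an R-periodic function on ℝ², one has ‖f₂‖_{L^p(K_R)} ≤ C_p (‖∇|f₂|‖_{L²(K_R)} + ‖f₂‖_{L²(K_R)}). -/
open MeasureTheory

/-- The square `K_R = (0,R)²`. -/
def KR (R : ℝ) : Set (ℝ × ℝ) := Set.Ioo 0 R ×ˢ Set.Ioo 0 R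

lemma aux_fderiv (f : ℝ × ℝ → ℂ) (hf : Differentiable ℝ f) (k : ℕ) :
    Differentiable ℝ (fun y => ‖f y‖ ^ (k + 2)) ∧ ∀ x,
      ‖fderiv ℝ (fun y => ‖f y‖ ^ (k + 2)) x‖ₑ ≤
        (k + 2 : ℕ) * (‖f x‖ₑ ^ (k + 1) * ‖fderiv ℝ (fun y => ‖f y‖) x‖ₑ) := by
  constructor
  · have h := hf.norm_rpow (p := ((k + 2 : ℕ) : ℝ)) (by push_cast; linarith [k.cast_nonneg (α := ℝ)])
    simpa only [Real.rpow_natCast] using h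
  · intro x
    by_cases hx : f x = 0
    · have : IsLocalMin (fun y => ‖f y‖ ^ (k + 2)) x := by
        refine Filter.Eventually.of_forall fun y => ?_
        simp only [hx, norm_zero]
        rw [zero_pow (by omega)]
        positivity
      rw [this.fderiv_eq_zero, ← ofReal_norm, norm_zero, ENNReal.ofReal_zero]
      exact bot_le
    · have hd : DifferentiableAt ℝ (fun y => ‖f y‖) x := (hf x).norm ℝ hx
      have h := (hd.hasFDerivAt.pow (k + 2)).fderiv
      rw [h, enorm_smul]
      refine le_of_eq ?_
      rw [← mul_assoc]
      congr 1
      simp only [nsmul_eq_mul, enorm_mul, enorm_pow, enorm_norm, Nat.add_succ_sub_one]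
      congr 1
      rw [Real.enorm_eq_ofReal (by positivity), ENNReal.ofReal_natCast]

lemma aux_1d (w : ℝ → ℝ) (hw : Differentiable ℝ w) (R : ℝ) (hR : 1 ≤ R) (x : ℝ)
    (hx : x ∈ Set.Ioo 0 R) :
    ‖w x‖ₑ ≤ ∫⁻ s in Set.Ioo 0 R, (‖w s‖ₑ + ‖deriv w s‖ₑ) := by
  have hm : Measurable (fun s => ‖w s‖ₑ) := hw.continuous.measurable.enorm
  have hm' : Measurable (fun s => ‖deriv w s‖ₑ) := (measurable_deriv w).enorm
  rw [lintegral_add_left hm]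
  set D := ∫⁻ s in Set.Ioo 0 R, ‖deriv w s‖ₑ with hD
  by_cases hDt : D = ⊤
  · simp [hDt]
  have hint : IntegrableOn (deriv w) (Set.Ioo 0 R) :=
    ⟨(measurable_deriv w).aestronglyMeasurable, lt_top_iff_ne_top.2 hDt⟩
  have key : ∀ s ∈ Set.Ioo 0 R, ‖w x‖ₑ ≤ ‖w s‖ₑ + D := by
    intro s hs
    have hsub : Set.uIcc s x ⊆ Set.Ioo 0 R := (Set.ordConnected_Ioo).uIcc_subset hs hx
    have hsub' : Set.uIoc s x ⊆ Set.Ioo 0 R := Set.uIoc_subset_uIcc.trans hsub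
    have hii : IntervalIntegrable (deriv w) volume s x :=
      intervalIntegrable_iff.2 (hint.mono_set hsub')
    have hftc := intervalIntegral.integral_eq_sub_of_hasDerivAt
      (fun y _ => (hw y).hasDerivAt) hii
    have h1 : ‖w x - w s‖ₑ ≤ D := by
      rw [← hftc]
      calc ‖∫ y in s..x, deriv w y‖ₑ = ‖∫ y in Set.uIoc s x, deriv w y‖ₑ := by
            rw [← ofReal_norm, ← ofReal_norm,
              intervalIntegral.norm_intervalIntegral_eq]
        _ ≤ ∫⁻ y in Set.uIoc s x, ‖deriv w y‖ₑ := enorm_integral_le_lintegral_enorm _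
        _ ≤ D := lintegral_mono_set hsub'
    calc ‖w x‖ₑ = ‖w s + (w x - w s)‖ₑ := by congr 1; ring
      _ ≤ ‖w s‖ₑ + ‖w x - w s‖ₑ := enorm_add_le _ _
      _ ≤ _ := by gcongr
  have hsub1 : Set.Ioo (0:ℝ) 1 ⊆ Set.Ioo 0 R := Set.Ioo_subset_Ioo_right hR
  calc ‖w x‖ₑ = ∫⁻ s in Set.Ioo (0:ℝ) 1, ‖w x‖ₑ := by simp
    _ ≤ ∫⁻ s in Set.Ioo (0:ℝ) 1, (‖w s‖ₑ + D) :=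
        setLIntegral_mono (hm.add_const _) fun s hs => key s (hsub1 hs)
    _ = (∫⁻ s in Set.Ioo (0:ℝ) 1, ‖w s‖ₑ) + D := by
        rw [lintegral_add_left hm]; simp
    _ ≤ _ := by gcongr

lemma aux_2d (w : ℝ × ℝ → ℝ) (hw : Differentiable ℝ w) (R : ℝ) (hR : 1 ≤ R) :
    ∫⁻ z in KR R, ‖w z‖ₑ ^ 2 ≤ (∫⁻ z in KR R, (‖w z‖ₑ + ‖fderiv ℝ w z‖ₑ)) ^ 2 := by
  set h : ℝ × ℝ → ENNReal := fun z => ‖w z‖ₑ + ‖fderiv ℝ w z‖ₑ with hh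
  have hhm : Measurable h :=
    hw.continuous.measurable.enorm.add (measurable_fderiv ℝ w).enorm
  have hK : (volume.restrict (KR R) : Measure (ℝ × ℝ)) =
      (volume.restrict (Set.Ioo 0 R)).prod (volume.restrict (Set.Ioo 0 R)) := by
    rw [Measure.prod_restrict, ← Measure.volume_eq_prod]; rfl
  have hKm : MeasurableSet (KR R) := measurableSet_Ioo.prod measurableSet_Ioo
  have h1 : ∀ z ∈ KR R, ‖w z‖ₑ ≤ ∫⁻ s in Set.Ioo 0 R, h (s, z.2) := by
    rintro ⟨a, b⟩ hz
    have hd : ∀ s, HasDerivAt (fun s => w (s, b)) (fderiv ℝ w (s, b) (1, 0)) s := fun s =>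
      (hw (s, b)).hasFDerivAt.comp_hasDerivAt s ((hasDerivAt_id s).prodMk (hasDerivAt_const s b))
    refine (aux_1d (fun s => w (s, b)) (fun s => (hd s).differentiableAt) R hR a hz.1).trans ?_
    refine lintegral_mono fun s => ?_
    simp only [hh, (hd s).deriv]
    gcongr
    refine ((fderiv ℝ w (s, b)).le_opENorm _).trans ?_
    have : ‖((1 : ℝ), (0 : ℝ))‖ₑ = 1 := by
      rw [← ofReal_norm]; simp [Prod.norm_def]
    rw [this, mul_one]
  have h2 : ∀ z ∈ KR R, ‖w z‖ₑ ≤ ∫⁻ s in Set.Ioo 0 R, h (z.1, s) := by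
    rintro ⟨a, b⟩ hz
    have hd : ∀ s, HasDerivAt (fun s => w (a, s)) (fderiv ℝ w (a, s) (0, 1)) s := fun s =>
      (hw (a, s)).hasFDerivAt.comp_hasDerivAt s ((hasDerivAt_const s a).prodMk (hasDerivAt_id s))
    refine (aux_1d (fun s => w (a, s)) (fun s => (hd s).differentiableAt) R hR b hz.2).trans ?_
    refine lintegral_mono fun s => ?_
    simp only [hh, (hd s).deriv]
    gcongr
    refine ((fderiv ℝ w (a, s)).le_opENorm _).trans ?_
    have : ‖((0 : ℝ), (1 : ℝ))‖ₑ = 1 := by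
      rw [← ofReal_norm]; simp [Prod.norm_def]
    rw [this, mul_one]
  calc ∫⁻ z in KR R, ‖w z‖ₑ ^ 2
      ≤ ∫⁻ z in KR R, (∫⁻ s in Set.Ioo 0 R, h (z.1, s)) * (∫⁻ s in Set.Ioo 0 R, h (s, z.2)) := by
        refine setLIntegral_mono' hKm fun z hz => ?_
        rw [sq]
        exact mul_le_mul' (h2 z hz) (h1 z hz)
    _ = (∫⁻ z in KR R, h z) ^ 2 := by
        rw [hK, lintegral_prod_mul (f := fun a => ∫⁻ s in Set.Ioo 0 R, h (a, s))
          (g := fun b => ∫⁻ s in Set.Ioo 0 R, h (s, b))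
          hhm.lintegral_prod_right'.aemeasurable hhm.lintegral_prod_left'.aemeasurable,
          ← lintegral_prod _ hhm.aemeasurable, ← lintegral_prod_symm _ hhm.aemeasurable, sq]

lemma aux_sq {α : Type*} [MeasurableSpace α] (μ : Measure α) (F : α → ENNReal) :
    eLpNorm F 2 μ ^ 2 = ∫⁻ x, F x ^ 2 ∂μ := by
  rw [eLpNorm_eq_lintegral_rpow_enorm_toReal (by norm_num) (by norm_num)]
  rw [← ENNReal.rpow_natCast, ← ENNReal.rpow_mul]
  simp

lemma aux_step (f : ℝ × ℝ → ℂ) (hf : Differentiable ℝ f) (R : ℝ) (hR : 1 ≤ R) (k : ℕ) :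
    ∫⁻ z in KR R, ‖f z‖ₑ ^ (2 * (k + 2)) ≤
      ((k + 2 : ℕ) * (eLpNorm (fun x => ‖fderiv ℝ (fun y => ‖f y‖) x‖) 2 (volume.restrict (KR R)) +
            eLpNorm f 2 (volume.restrict (KR R)))) ^ 2 *
      ∫⁻ z in KR R, ‖f z‖ₑ ^ (2 * (k + 1)) := by
  set μ : Measure (ℝ × ℝ) := volume.restrict (KR R)
  obtain ⟨hd, hb⟩ := aux_fderiv f hf k
  set g : ℝ × ℝ → ENNReal := fun x => ‖fderiv ℝ (fun y => ‖f y‖) x‖ₑ with hg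
  have hgm : Measurable g := (measurable_fderiv ℝ _).enorm
  have hfm : Measurable (fun x => ‖f x‖ₑ) := hf.continuous.measurable.enorm
  have h := aux_2d _ hd R hR
  have e1 : ∀ z, ‖‖f z‖ ^ (k + 2)‖ₑ = ‖f z‖ₑ ^ (k + 2) := fun z => by
    rw [enorm_pow, enorm_norm]
  simp only [e1] at h
  set S : ℝ × ℝ → ENNReal := fun z => ‖f z‖ₑ + g z
  have hSm : Measurable S := hfm.add hgm
  have hS : eLpNorm S 2 μ ≤ eLpNorm (fun x => ‖fderiv ℝ (fun y => ‖f y‖) x‖) 2 μ +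
            eLpNorm f 2 μ := by
    have := eLpNorm_add_le (μ := μ) (p := 2) (f := fun z => ‖f z‖ₑ) (g := g)
      hfm.aestronglyMeasurable hgm.aestronglyMeasurable (by norm_num)
    refine this.trans ?_
    rw [add_comm]
    refine add_le_add (le_of_eq ?_) (le_of_eq ?_)
    · rw [eLpNorm_norm]; exact eLpNorm_enorm _
    · exact eLpNorm_enorm _
  have hpt : ∀ z, ‖f z‖ₑ ^ (k + 2) + ‖fderiv ℝ (fun y => ‖f y‖ ^ (k + 2)) z‖ₑ ≤
      (k + 2 : ℕ) * (((fun z => ‖f z‖ₑ ^ (k + 1)) * S) z) := by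
    intro z
    simp only [Pi.mul_apply, S, mul_add]
    refine add_le_add ?_ (hb z)
    rw [← pow_succ]
    exact le_mul_of_one_le_left' (by exact_mod_cast (by omega : 1 ≤ k + 2))
  have hcs : ∫⁻ z, ((fun z => ‖f z‖ₑ ^ (k + 1)) * S) z ∂μ ≤
      (∫⁻ z, ‖f z‖ₑ ^ (2 * (k + 1)) ∂μ) ^ (1 / 2 : ℝ) * eLpNorm S 2 μ := by
    refine (ENNReal.lintegral_mul_le_Lp_mul_Lq μ Real.HolderConjugate.two_two
      (hfm.pow_const _).aemeasurable hSm.aemeasurable).trans (le_of_eq ?_)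
    congr 1
    · congr 2
      ext z
      rw [mul_comm 2, pow_mul]
      exact_mod_cast ENNReal.rpow_natCast _ 2
    · rw [eLpNorm_eq_lintegral_rpow_enorm_toReal (by norm_num) (by norm_num)]
      simp
  have e2 : ∀ z, (‖f z‖ₑ ^ (k + 2)) ^ 2 = ‖f z‖ₑ ^ (2 * (k + 2)) := fun z => by
    rw [← pow_mul, mul_comm]
  simp only [e2] at h
  refine h.trans ?_
  calc _ ≤ ((k + 2 : ℕ) * ((∫⁻ z, ‖f z‖ₑ ^ (2 * (k + 1)) ∂μ) ^ (1 / 2 : ℝ) * eLpNorm S 2 μ)) ^ 2 := by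
        gcongr
        refine (lintegral_mono hpt).trans ?_
        rw [lintegral_const_mul _ ((hfm.pow_const _).mul hSm)]
        gcongr
    _ = ((k + 2 : ℕ) * eLpNorm S 2 μ) ^ 2 * ∫⁻ z, ‖f z‖ₑ ^ (2 * (k + 1)) ∂μ := by
        have : ((∫⁻ z, ‖f z‖ₑ ^ (2 * (k + 1)) ∂μ) ^ (1 / 2 : ℝ)) ^ 2 =
            ∫⁻ z, ‖f z‖ₑ ^ (2 * (k + 1)) ∂μ := by
          rw [← ENNReal.rpow_natCast, ← ENNReal.rpow_mul]; simp
        rw [mul_left_comm, mul_pow, this, mul_comm]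
    _ ≤ _ := by gcongr

lemma aux_even (f : ℝ × ℝ → ℂ) (hf : Differentiable ℝ f) (R : ℝ) (hR : 1 ≤ R) (k : ℕ) :
    ∫⁻ z in KR R, ‖f z‖ₑ ^ (2 * (k + 1)) ≤
      ((((k + 1).factorial ^ 2 : ℕ)) : ENNReal) *
      (eLpNorm (fun x => ‖fderiv ℝ (fun y => ‖f y‖) x‖) 2 (volume.restrict (KR R)) +
            eLpNorm f 2 (volume.restrict (KR R))) ^ (2 * (k + 1)) := by
  induction k with
  | zero =>
    have := aux_sq (volume.restrict (KR R)) (fun z => ‖f z‖ₑ)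
    simp only [zero_add, mul_one, Nat.factorial_one, one_pow, Nat.cast_one, one_mul]
    rw [← this]
    gcongr
    rw [eLpNorm_enorm]
    exact le_add_self
  | succ k ih =>
    refine (aux_step f hf R hR k).trans ?_
    refine (mul_le_mul_right ih _).trans (le_of_eq ?_)
    rw [Nat.factorial_succ (k + 1)]
    push_cast
    ring

theorem stmt1 (p : ℝ) (hp : 2 ≤ p) :
    ∃ C > 0, ∀ R : ℝ, 1 ≤ R → ∀ f₂ : ℝ × ℝ → ℂ,
      Differentiable ℝ f₂ →
      (∀ x : ℝ × ℝ, ‖f₂ (x + (R, 0))‖ = ‖f₂ x‖) →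
      (∀ x : ℝ × ℝ, ‖f₂ (x + (0, R))‖ = ‖f₂ x‖) →
      eLpNorm f₂ (ENNReal.ofReal p) (volume.restrict (KR R)) ≤
        ENNReal.ofReal C *
          (eLpNorm (fun x => ‖fderiv ℝ (fun y => ‖f₂ y‖) x‖) 2 (volume.restrict (KR R)) +
            eLpNorm f₂ 2 (volume.restrict (KR R))) := by
  obtain ⟨n, hn⟩ := exists_nat_ge p
  set c : ℕ := (n + 1).factorial ^ 2 with hc
  refine ⟨((1 + c : ℕ) : ℝ), by positivity, ?_⟩
  intro R hR f hf _ _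
  have h2 := aux_even f hf R hR 0
  have hN := aux_even f hf R hR n
  set A := eLpNorm (fun x => ‖fderiv ℝ (fun y => ‖f y‖) x‖) 2 (volume.restrict (KR R)) +
            eLpNorm f 2 (volume.restrict (KR R)) with hA
  have hfm : Measurable (fun x => ‖f x‖ₑ) := hf.continuous.measurable.enorm
  rw [ENNReal.ofReal_natCast]
  have hC0 : ((1 + c : ℕ) : ENNReal) ≠ 0 := by positivity
  by_cases hAt : A = ⊤
  · rw [hAt, ENNReal.mul_top hC0]; exact le_top
  by_cases hA0 : A = 0
  · have h0 : eLpNorm f 2 (volume.restrict (KR R)) = 0 := (add_eq_zero.1 (hA ▸ hA0)).2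
    rw [eLpNorm_eq_zero_iff hf.continuous.aestronglyMeasurable (by norm_num)] at h0
    rw [eLpNorm_congr_ae h0]
    simp
  have hp0 : 0 < p := by linarith
  have hpe : ENNReal.ofReal p ≠ 0 := by simpa using hp0
  rw [eLpNorm_eq_lintegral_rpow_enorm_toReal hpe ENNReal.ofReal_ne_top,
    ENNReal.toReal_ofReal hp0.le]
  set N : ℕ := 2 * (n + 1) with hNdef
  have hpN : p ≤ (N : ℝ) := by
    rw [hNdef]; push_cast; linarith [n.cast_nonneg (α := ℝ)]
  have hpt : ∀ x, ‖f x‖ₑ ^ p ≤ A ^ (p - 2) * ‖f x‖ₑ ^ 2 + A ^ (p - N) * ‖f x‖ₑ ^ N := by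
    intro x
    rcases le_or_gt ‖f x‖ₑ A with hle | hgt
    · refine le_trans ?_ le_self_add
      have : ‖f x‖ₑ ^ p = ‖f x‖ₑ ^ (p - 2) * ‖f x‖ₑ ^ 2 := by
        rw [← ENNReal.rpow_natCast ‖f x‖ₑ 2, ← ENNReal.rpow_add_of_nonneg _ _ (by linarith) (by simp)]
        congr 1; push_cast; ring
      rw [this]
      gcongr
    · refine le_trans ?_ le_add_self
      have hx0 : ‖f x‖ₑ ≠ 0 := (bot_le.trans_lt hgt).ne'
      have : ‖f x‖ₑ ^ p = ‖f x‖ₑ ^ (p - N) * ‖f x‖ₑ ^ N := by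
        rw [← ENNReal.rpow_natCast ‖f x‖ₑ N, ← ENNReal.rpow_add _ _ hx0 enorm_ne_top]
        congr 1; ring
      rw [this]
      gcongr ?_ * _
      rw [← neg_sub (N : ℝ) p, ENNReal.rpow_neg, ENNReal.rpow_neg]
      exact ENNReal.inv_le_inv.2 (ENNReal.rpow_le_rpow hgt.le (by linarith))
  have hI : ∫⁻ x in KR R, ‖f x‖ₑ ^ p ≤ ((1 + c : ℕ) : ENNReal) * A ^ p := by
    calc _ ≤ ∫⁻ x in KR R, (A ^ (p - 2) * ‖f x‖ₑ ^ 2 + A ^ (p - N) * ‖f x‖ₑ ^ N) :=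
          lintegral_mono hpt
      _ = A ^ (p - 2) * (∫⁻ x in KR R, ‖f x‖ₑ ^ 2) + A ^ (p - N) * ∫⁻ x in KR R, ‖f x‖ₑ ^ N := by
          rw [lintegral_add_left ((hfm.pow_const 2).const_mul _),
            lintegral_const_mul _ (hfm.pow_const 2), lintegral_const_mul _ (hfm.pow_const N)]
      _ ≤ A ^ (p - 2) * A ^ 2 + A ^ (p - N) * (c * A ^ N) := by
          gcongr
          simpa using h2
      _ = _ := by
          have a1 : A ^ (p - 2) * A ^ 2 = A ^ p := by
            rw [← ENNReal.rpow_natCast A 2, ← ENNReal.rpow_add _ _ hA0 hAt]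
            congr 1; push_cast; ring
          have a2 : A ^ (p - N) * A ^ N = A ^ p := by
            rw [← ENNReal.rpow_natCast A N, ← ENNReal.rpow_add _ _ hA0 hAt]
            congr 1; ring
          rw [a1, mul_left_comm, a2]
          push_cast; ring
  calc _ ≤ (((1 + c : ℕ) : ENNReal) * A ^ p) ^ (1 / p) := by gcongr
    _ = ((1 + c : ℕ) : ENNReal) ^ (1 / p) * A := by
        rw [ENNReal.mul_rpow_of_nonneg _ _ (by positivity), ← ENNReal.rpow_mul,
          mul_one_div_cancel hp0.ne', ENNReal.rpow_one]
    _ ≤ _ := by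
        gcongr
        calc ((1 + c : ℕ) : ENNReal) ^ (1 / p) ≤ ((1 + c : ℕ) : ENNReal) ^ (1 : ℝ) :=
              ENNReal.rpow_le_rpow_of_exponent_le (by exact_mod_cast (by omega : 1 ≤ 1 + c))
                (by rw [div_le_one hp0]; linarith)
          _ = _ := ENNReal.rpow_one _
end

section
/- Let P_R = −(∇ − iA₀)² be the Landau operator with magnetic-periodic boundary conditions on the cell K_R of the lattice R(ℤ ⊕ iℤ), with R² = 2πN for some N ∈ ℕ. Then the lowest eigenvalue of P_R equals 1, the second distinct eigenvalue is at least 3, and the ground-state eigenspace ker(P_R − 1) has complex dimension N = |K_R|/(2π). Moreover ker(P_R − 1) = { u ∈ E_R : (∂_{x₁} + i∂_{x₂} + ½(x₁ + ix₂)) u = 0 }. -/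
open MeasureTheory

/-- The canonical vector potential `A₀(x₁,x₂) = ½(-x₂, x₁)`. -/
noncomputable def A0 (x : ℝ × ℝ) : ℝ × ℝ := (-x.2 / 2, x.1 / 2)

/-- First component of the magnetic gradient `(∇ - i A₀)u`. -/
noncomputable def mg1 (u : ℝ × ℝ → ℂ) (x : ℝ × ℝ) : ℂ :=
  fderiv ℝ u x (1, 0) - Complex.I * ((A0 x).1 : ℂ) * u x

/-- Second component of the magnetic gradient `(∇ - i A₀)u`. -/
noncomputable def mg2 (u : ℝ × ℝ → ℂ) (x : ℝ × ℝ) : ℂ :=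
  fderiv ℝ u x (0, 1) - Complex.I * ((A0 x).2 : ℂ) * u x

/-- The magnetic Laplacian `(∇ - i A₀)²u`. -/
noncomputable def magLap (u : ℝ × ℝ → ℂ) (x : ℝ × ℝ) : ℂ :=
  mg1 (mg1 u) x + mg2 (mg2 u) x

/-- Magnetic-periodicity conditions defining the space `E_R`. -/
def inER (R : ℝ) (N : ℕ) (u : ℝ × ℝ → ℂ) : Prop :=
  (∀ z : ℝ × ℝ, u (z.1 + R, z.2) =
      Complex.exp (Complex.I * ((Real.pi * N * z.2 / R : ℝ) : ℂ)) * u z) ∧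
  (∀ z : ℝ × ℝ, u (z.1, z.2 + R) =
      Complex.exp (-(Complex.I * ((Real.pi * N * z.1 / R : ℝ) : ℂ))) * u z)

/-- The annihilation equation `(∂₁ + i∂₂ + ½(x₁ + ix₂))u = 0`. -/
def annihilated (u : ℝ × ℝ → ℂ) : Prop :=
  ∀ x : ℝ × ℝ, fderiv ℝ u x (1, 0) + Complex.I * fderiv ℝ u x (0, 1) +
    (1 / 2 : ℂ) * ((x.1 : ℂ) + Complex.I * (x.2 : ℂ)) * u x = 0

/-- Elements of `ker(P_R - 1)`. -/
def groundState (R : ℝ) (N : ℕ) (u : ℝ × ℝ → ℂ) : Prop :=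
  Differentiable ℝ u ∧ inER R N u ∧ annihilated u

/-- The quadratic form `Q_R(f) = ‖(∇ - iA₀)f‖²_{L²(K_R)}`. -/
noncomputable def QR (R : ℝ) (f : ℝ × ℝ → ℂ) : ℝ :=
  ∫ x in KR R, (‖mg1 f x‖ ^ 2 + ‖mg2 f x‖ ^ 2)


lemma locInt_interval {d : ℝ → ℝ} (hd : LocallyIntegrable d) (a b : ℝ) :
    IntervalIntegrable d volume a b :=
  (hd.integrableOn_isCompact isCompact_uIcc).intervalIntegrable

lemma prim_ac {f d : ℝ → ℝ} (hd : LocallyIntegrable d)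
    (hf : ∀ a b, f b - f a = ∫ t in a..b, d t) (a b : ℝ) :
    AbsolutelyContinuousOnInterval f a b := by
  have h1 : f = fun x => (fun _ => f a) x + (fun x => ∫ t in a..x, d t) x := by
    funext x; simp only; rw [← hf a x]; ring
  rw [h1]
  refine AbsolutelyContinuousOnInterval.add ?_ ?_
  · exact (contDiffOn_const (n := 1)).absolutelyContinuousOnInterval
  · exact (locInt_interval hd a b).absolutelyContinuousOnInterval_intervalIntegral (by simp)

lemma prim_ae_deriv {f d : ℝ → ℝ} (hd : LocallyIntegrable d)
    (hf : ∀ a b, f b - f a = ∫ t in a..b, d t) : ∀ᵐ x, deriv f x = d x := by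
  filter_upwards [_root_.LocallyIntegrable.ae_hasDerivAt_integral hd] with x hx
  have h1 : f = fun x => f 0 + (∫ t in (0:ℝ)..x, d t) := by
    funext x; rw [← hf 0 x]; ring
  rw [h1]
  exact ((hx 0).const_add _).deriv

lemma prim_mul {f g d e : ℝ → ℝ} (hd : LocallyIntegrable d) (he : LocallyIntegrable e)
    (hf : ∀ a b, f b - f a = ∫ t in a..b, d t) (hg : ∀ a b, g b - g a = ∫ t in a..b, e t)
    (a b : ℝ) : f b * g b - f a * g a = ∫ t in a..b, (d t * g t + f t * e t) := by
  rw [← (prim_ac hd hf a b).integral_deriv_mul_eq_sub (prim_ac he hg a b)]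
  apply intervalIntegral.integral_congr_ae
  filter_upwards [prim_ae_deriv hd hf, prim_ae_deriv he hg] with x h1 h2 _
  rw [h1, h2]

lemma prim_cont {f d : ℝ → ℝ} (hd : LocallyIntegrable d)
    (hf : ∀ a b, f b - f a = ∫ t in a..b, d t) : Continuous f := by
  have h1 : f = fun x => f 0 + (∫ t in (0:ℝ)..x, d t) := by
    funext x; rw [← hf 0 x]; ring
  rw [h1]
  exact continuous_const.add (intervalIntegral.continuous_primitive (fun a b => locInt_interval hd a b) 0)

lemma prim_integral_zero {F d : ℝ → ℝ} (hd : Integrable d) (hF : Integrable F)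
    (hf : ∀ a b, F b - F a = ∫ t in a..b, d t) : ∫ t, d t = 0 := by
  have top : Filter.Tendsto F Filter.atTop (nhds (F 0 + ∫ t in Set.Ioi (0:ℝ), d t)) := by
    have h1 : F = fun x => F 0 + (∫ t in (0:ℝ)..x, d t) := by
      funext x; rw [← hf 0 x]; ring
    conv => enter [1]; rw [h1]
    exact (intervalIntegral_tendsto_integral_Ioi 0 hd.integrableOn Filter.tendsto_id).const_add _
  have bot : Filter.Tendsto F Filter.atBot (nhds (F 0 - ∫ t in Set.Iic (0:ℝ), d t)) := by
    have h1 : F = fun x => F 0 - (∫ t in x..(0:ℝ), d t) := by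
      funext x; rw [← hf x 0]; ring
    conv => enter [1]; rw [h1]
    exact (intervalIntegral_tendsto_integral_Iic 0 hd.integrableOn Filter.tendsto_id).const_sub _
  have t0 := (hF.integrableAtFilter Filter.atTop).eq_zero_of_tendsto (fun s hs => by
    obtain ⟨a, ha⟩ := Filter.mem_atTop_sets.1 hs
    refine top_unique ?_
    rw [← Real.volume_Ici (a := a)]
    exact measure_mono ha) top
  have b0 := (hF.integrableAtFilter Filter.atBot).eq_zero_of_tendsto (fun s hs => by
    obtain ⟨a, ha⟩ := Filter.mem_atBot_sets.1 hs
    refine top_unique ?_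
    rw [← Real.volume_Iic (a := a)]
    exact measure_mono ha) bot
  have := intervalIntegral.integral_Iic_add_Ioi (b := (0:ℝ)) (f := d) (μ := volume) hd.integrableOn hd.integrableOn
  linarith

lemma locInt_of_memLp {d : ℝ → ℝ} (hd : MemLp d 2) : LocallyIntegrable d :=
  hd.locallyIntegrable (by norm_num)

/-- Integration by parts identity for the harmonic oscillator. -/
lemma ho_identity {g d : ℝ → ℝ} (hd : MemLp d 2) (hg : MemLp g 2)
    (htg : MemLp (fun t => t * g t) 2)
    (hf : ∀ a b, g b - g a = ∫ t in a..b, d t) :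
    (∫ t, d t ^ 2) + (∫ t, (t * g t) ^ 2) = (∫ t, (d t + t * g t) ^ 2) + ∫ t, g t ^ 2 := by
  have hdl := locInt_of_memLp hd
  have hgc := prim_cont hdl hf
  have hgl : LocallyIntegrable (fun t => d t * g t + g t * d t) := by
    have := (hd.integrable_mul hg).add (hg.integrable_mul hd)
    exact this.locallyIntegrable
  have h1 := prim_mul hdl hdl hf hf
  have h2 : ∀ a b : ℝ, (fun t : ℝ => t) b - (fun t : ℝ => t) a = ∫ t in a..b, (fun _ : ℝ => (1:ℝ)) t := by
    intro a b; simp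
  have h3 := prim_mul (f := fun t : ℝ => t) (g := fun t => g t * g t) (d := fun _ : ℝ => (1:ℝ))
    (continuous_const.locallyIntegrable) hgl h2 h1
  have i1 : Integrable (fun t => g t ^ 2) := hg.integrable_sq
  have i2 : Integrable (fun t => (t * g t) * d t) := htg.integrable_mul hd
  have i3 : Integrable (fun t => d t ^ 2) := hd.integrable_sq
  have i4 : Integrable (fun t => (t * g t) ^ 2) := htg.integrable_sq
  have i5 : Integrable (fun t => (t * g t) * g t) := htg.integrable_mul hg
  have e1 : (fun t => 1 * (g t * g t) + t * (d t * g t + g t * d t)) =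
      fun t => g t ^ 2 + 2 * ((t * g t) * d t) := by funext t; ring
  have h4 : ∫ t, (g t ^ 2 + 2 * ((t * g t) * d t)) = 0 := by
    refine prim_integral_zero (F := fun t => t * (g t * g t)) (i1.add (i2.const_mul 2)) ?_ ?_
    · refine i5.congr (Filter.Eventually.of_forall fun t => ?_); simp only; ring
    · intro a b
      rw [← e1]; exact h3 a b
  rw [integral_add i1 (i2.const_mul 2)] at h4
  have e2 : (fun t => (d t + t * g t) ^ 2) = fun t => (d t ^ 2 + (t * g t) ^ 2) + 2 * ((t * g t) * d t) := by
    funext t; ring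
  have i34 : Integrable (fun t => d t ^ 2 + (t * g t) ^ 2) := i3.add i4
  rw [e2, integral_add i34 (i2.const_mul 2), integral_add i3 i4]
  linarith

lemma cs_interval {m : ℝ → ℝ} {x y : ℝ} (hxy : y < x) (h1 : IntervalIntegrable m volume y x)
    (h2 : IntervalIntegrable (fun t => m t ^ 2) volume y x) :
    (∫ t in y..x, m t) ^ 2 ≤ (x - y) * ∫ t in y..x, m t ^ 2 := by
  set I := ∫ t in y..x, m t
  set c := I / (x - y)
  have h0 : 0 ≤ ∫ t in y..x, (m t - c) ^ 2 :=
    intervalIntegral.integral_nonneg hxy.le (fun t _ => sq_nonneg _)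
  have e : (fun t => (m t - c) ^ 2) = fun t => (m t ^ 2 - (2 * c) * m t) + c ^ 2 := by
    funext t; ring
  rw [e, intervalIntegral.integral_add (h2.sub (h1.const_mul _)) (by simp),
    intervalIntegral.integral_sub h2 (h1.const_mul _), intervalIntegral.integral_const_mul,
    intervalIntegral.integral_const] at h0
  have hp : 0 < x - y := by linarith
  have hc : c * (x - y) = I := by simp only [c]; field_simp
  simp only [smul_eq_mul] at h0
  have := mul_nonneg hp.le h0
  change 0 ≤ (x - y) * ((∫ t in y..x, m t ^ 2) - 2 * c * I + (x - y) * c ^ 2) at this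
  nlinarith

lemma gauss_int : Integrable (fun t : ℝ => Real.exp (-t ^ 2)) := by
  simpa using integrable_exp_neg_mul_sq (b := 1) one_pos
lemma gauss_mul_int : Integrable (fun t : ℝ => t * Real.exp (-t ^ 2)) := by
  simpa using integrable_mul_exp_neg_mul_sq (b := 1) one_pos
lemma gauss_val : ∫ t : ℝ, Real.exp (-t ^ 2) = √Real.pi := by
  simpa using integral_gaussian 1

lemma gauss_Ioi (s : ℝ) : ∫ t in Set.Ioi s, t * Real.exp (-t ^ 2) = Real.exp (-s ^ 2) / 2 := by
  have hd : ∀ t : ℝ, HasDerivAt (fun t : ℝ => - Real.exp (-t ^ 2) / 2) (t * Real.exp (-t ^ 2)) t := by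
    intro t
    have := (((hasDerivAt_pow 2 t).neg).exp.neg).div_const 2
    refine this.congr_deriv ?_
    norm_num; ring
  have := integral_Ioi_of_hasDerivAt_of_tendsto (f := fun t : ℝ => - Real.exp (-t ^ 2) / 2) (a := s) (m := 0)
    (hd s).continuousAt.continuousWithinAt (fun t _ => hd t) gauss_mul_int.integrableOn ?_
  · rw [this]; ring
  · have h : Filter.Tendsto (fun t : ℝ => Real.exp (-t ^ 2)) Filter.atTop (nhds 0) :=
      Real.tendsto_exp_neg_atTop_nhds_zero.comp (Filter.tendsto_pow_atTop (by norm_num))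
    simpa using h.neg.div_const 2

lemma gauss_mul_zero : ∫ t : ℝ, t * Real.exp (-t ^ 2) = 0 := by
  have h := integral_neg_eq_self (fun t : ℝ => t * Real.exp (-t ^ 2)) volume
  simp only [neg_mul, neg_sq] at h
  rw [integral_neg] at h
  linarith

lemma gauss_Iic (s : ℝ) : ∫ t in Set.Iic s, t * Real.exp (-t ^ 2) = -Real.exp (-s ^ 2) / 2 := by
  have := intervalIntegral.integral_Iic_add_Ioi (b := s) (μ := volume) gauss_mul_int.integrableOn gauss_mul_int.integrableOn
  rw [gauss_mul_zero, gauss_Ioi] at this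
  linarith

lemma kernel_val (s : ℝ) : ∫⁻ z in (Set.Ioi s ×ˢ Set.Iic s : Set (ℝ × ℝ)),
    ENNReal.ofReal ((z.1 - z.2) * (Real.exp (-z.1 ^ 2) * Real.exp (-z.2 ^ 2))) =
    ENNReal.ofReal (Real.exp (-s ^ 2) / 2 * √Real.pi) := by
  have e : (fun z : ℝ × ℝ => (z.1 - z.2) * (Real.exp (-z.1 ^ 2) * Real.exp (-z.2 ^ 2))) =
     fun z => (z.1 * Real.exp (-z.1 ^ 2)) * Real.exp (-z.2 ^ 2) - Real.exp (-z.1 ^ 2) * (z.2 * Real.exp (-z.2 ^ 2)) := by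
    funext z; ring
  have i1 : Integrable (fun z : ℝ × ℝ => (z.1 * Real.exp (-z.1 ^ 2)) * Real.exp (-z.2 ^ 2)) :=
    gauss_mul_int.mul_prod gauss_int
  have i2 : Integrable (fun z : ℝ × ℝ => Real.exp (-z.1 ^ 2) * (z.2 * Real.exp (-z.2 ^ 2))) :=
    gauss_int.mul_prod gauss_mul_int
  rw [← ofReal_integral_eq_lintegral_ofReal]
  · rw [e, integral_sub i1.integrableOn i2.integrableOn]
    have a1 := setIntegral_prod_mul (μ := volume) (ν := volume) (fun t : ℝ => t * Real.exp (-t ^ 2)) (fun t : ℝ => Real.exp (-t ^ 2)) (Set.Ioi s) (Set.Iic s)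
    have a2 := setIntegral_prod_mul (μ := volume) (ν := volume) (fun t : ℝ => Real.exp (-t ^ 2)) (fun t : ℝ => t * Real.exp (-t ^ 2)) (Set.Ioi s) (Set.Iic s)
    rw [← Measure.volume_eq_prod] at a1 a2
    rw [a1, a2, gauss_Ioi, gauss_Iic, ← gauss_val]
    have := intervalIntegral.integral_Iic_add_Ioi (b := s) (μ := volume) gauss_int.integrableOn gauss_int.integrableOn
    rw [← this]
    congr 1; ring
  · rw [e]; exact (i1.sub i2).integrableOn
  · filter_upwards [ae_restrict_mem (measurableSet_Ioi.prod measurableSet_Iic)] with z hz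
    have h1 : s < z.1 := hz.1
    have h2 : z.2 ≤ s := hz.2
    have : 0 ≤ z.1 - z.2 := by linarith
    simp only [Pi.zero_apply]
    positivity

/-- One dimensional Gaussian Poincare inequality in ground-state form. -/
lemma ho_poincare {g d : ℝ → ℝ} (hdm : Measurable d) (hd : MemLp d 2) (hg : MemLp g 2)
    (htg : MemLp (fun t => t * g t) 2)
    (hf : ∀ a b, g b - g a = ∫ t in a..b, d t)
    (horth : ∫ t, Real.exp (-t ^ 2 / 2) * g t = 0) :
    2 * ∫ t, g t ^ 2 ≤ ∫ t, (d t + t * g t) ^ 2 := by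
  have hdl := locInt_of_memLp hd
  have hgc := prim_cont hdl hf
  set E : ℝ → ℝ := fun t => Real.exp (t ^ 2 / 2) with hE
  have hEc : Continuous E := by fun_prop
  have hEd : ∀ t, HasDerivAt E (t * E t) t := by
    intro t
    have := ((hasDerivAt_pow 2 t).div_const 2).exp
    refine this.congr_deriv ?_
    simp only [hE]; norm_num; ring
  have hE' : ∀ a b, E b - E a = ∫ t in a..b, t * E t := by
    intro a b
    rw [intervalIntegral.integral_eq_sub_of_hasDerivAt (fun x _ => hEd x)
      ((continuous_id.mul hEc).intervalIntegrable a b)]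
  have hEl : LocallyIntegrable (fun t => t * E t) := (continuous_id.mul hEc).locallyIntegrable
  set q : ℝ → ℝ := fun t => d t + t * g t with hq
  have hq2 : MemLp q 2 := hd.add htg
  have hqm : Measurable q := hdm.add (measurable_id.mul hgc.measurable)
  set m : ℝ → ℝ := fun t => q t * E t with hm
  have hmm : Measurable m := hqm.mul hEc.measurable
  set w : ℝ → ℝ := fun t => g t * E t with hw
  have hwm : ∀ a b, w b - w a = ∫ t in a..b, m t := by
    intro a b
    rw [hw]; simp only
    rw [prim_mul hdl hEl hf hE' a b]
    congr 1; funext t; simp only [hm, hq]; ring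
  have hml : ∀ a b, IntervalIntegrable m volume a b := by
    intro a b
    exact (locInt_interval (locInt_of_memLp hq2) a b).mul_continuousOn hEc.continuousOn
  have hm2 : ∀ a b, IntervalIntegrable (fun t => m t ^ 2) volume a b := by
    intro a b
    have := (hq2.integrable_sq.intervalIntegrable (a := a) (b := b)).mul_continuousOn (hEc.pow 2).continuousOn
    refine this.congr (fun t _ => ?_)
    simp only [hm, Pi.pow_apply]; ring
  have hcs : ∀ x y, y < x → ENNReal.ofReal ((w x - w y) ^ 2) ≤
      ENNReal.ofReal (x - y) * ∫⁻ s in Set.Ico y x, ENNReal.ofReal (m s ^ 2) := by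
    intro x y hxy
    rw [hwm y x]
    refine (ENNReal.ofReal_le_ofReal (cs_interval hxy (hml y x) (hm2 y x))).trans ?_
    rw [ENNReal.ofReal_mul (by linarith), intervalIntegral.integral_of_le hxy.le,
      ofReal_integral_eq_lintegral_ofReal
        ((intervalIntegrable_iff_integrableOn_Ioc_of_le hxy.le).1 (hm2 y x))
        (Filter.Eventually.of_forall fun t => sq_nonneg _)]
    rw [Measure.restrict_congr_set Ico_ae_eq_Ioc]
  set p : ℝ → ℝ := fun t => Real.exp (-t ^ 2) with hp
  set ψ : ℝ → ℝ := fun t => Real.exp (-t ^ 2 / 2) with hψ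
  have hpc : Continuous p := by fun_prop
  -- the kernel
  set S : Set ((ℝ × ℝ) × ℝ) := {u | u.1.2 ≤ u.2 ∧ u.2 < u.1.1} with hS
  have hSm : MeasurableSet S := by
    have h1 : MeasurableSet {u : (ℝ × ℝ) × ℝ | u.1.2 ≤ u.2} :=
      measurableSet_le (by fun_prop) (by fun_prop)
    have h2 : MeasurableSet {u : (ℝ × ℝ) × ℝ | u.2 < u.1.1} :=
      measurableSet_lt (by fun_prop) (by fun_prop)
    exact h1.inter h2
  set k : (ℝ × ℝ) → ℝ → ENNReal := fun z s =>
    S.indicator (fun u => ENNReal.ofReal ((u.1.1 - u.1.2) * (p u.1.1 * p u.1.2)) * ENNReal.ofReal (m u.2 ^ 2)) (z, s) with hk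
  have hkm : Measurable (Function.uncurry k) := by
    have : Function.uncurry k = S.indicator (fun u => ENNReal.ofReal ((u.1.1 - u.1.2) * (p u.1.1 * p u.1.2)) * ENNReal.ofReal (m u.2 ^ 2)) := by
      funext u; rfl
    rw [this]
    apply Measurable.indicator _ hSm
    fun_prop
  have hle1 : ∀ z : ℝ × ℝ, z.2 < z.1 →
      ENNReal.ofReal ((w z.1 - w z.2) ^ 2 * (p z.1 * p z.2)) ≤ ∫⁻ s, k z s := by
    intro z hz
    have e : ∀ s, k z s = (Set.Ico z.2 z.1).indicator (fun s => ENNReal.ofReal ((z.1 - z.2) * (p z.1 * p z.2)) * ENNReal.ofReal (m s ^ 2)) s := by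
      intro s
      simp only [hk, hS, Set.indicator, Set.mem_ofPred_eq, Set.mem_Ico]
    simp_rw [e]
    rw [lintegral_indicator measurableSet_Ico, lintegral_const_mul _ (by fun_prop),
      ENNReal.ofReal_mul (sq_nonneg _), ENNReal.ofReal_mul (sub_nonneg.2 hz.le)]
    refine (mul_le_mul_left (hcs z.1 z.2 hz) _).trans (le_of_eq ?_)
    ring
  have hle : ∀ z : ℝ × ℝ, ENNReal.ofReal ((w z.1 - w z.2) ^ 2 * (p z.1 * p z.2)) ≤
      (∫⁻ s, k z s) + ∫⁻ s, k z.swap s := by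
    intro z
    rcases lt_trichotomy z.1 z.2 with h | h | h
    · refine le_trans ?_ le_add_self
      have := hle1 z.swap h
      simp only [Prod.fst_swap, Prod.snd_swap] at this
      refine le_trans (le_of_eq ?_) this
      congr 1; ring
    · rw [h]; simp
    · exact (hle1 z h).trans le_self_add
  have hI : ∫⁻ z : ℝ × ℝ, (∫⁻ s, k z s) = ENNReal.ofReal (√Real.pi / 2 * ∫ t, q t ^ 2) := by
    rw [lintegral_lintegral_swap hkm.aemeasurable]
    have : ∀ s, ∫⁻ z : ℝ × ℝ, k z s = ENNReal.ofReal (√Real.pi / 2 * q s ^ 2) := by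
      intro s
      have e : ∀ z, k z s = (Set.Ioi s ×ˢ Set.Iic s : Set (ℝ × ℝ)).indicator (fun z => ENNReal.ofReal ((z.1 - z.2) * (p z.1 * p z.2)) * ENNReal.ofReal (m s ^ 2)) z := by
        intro z
        simp only [hk, hS, Set.indicator, Set.mem_ofPred_eq, Set.mem_prod, Set.mem_Ioi, Set.mem_Iic, and_comm]
      simp_rw [e]
      rw [lintegral_indicator (measurableSet_Ioi.prod measurableSet_Iic), lintegral_mul_const _ (by fun_prop)]
      simp only [hp]
      rw [kernel_val, ← ENNReal.ofReal_mul (by positivity)]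
      congr 1
      simp only [hm, hE]
      have : Real.exp (-s ^ 2) * Real.exp (s ^ 2 / 2) ^ 2 = 1 := by
        rw [← Real.exp_nat_mul, ← Real.exp_add, ← Real.exp_zero]; congr 1; push_cast; ring
      linear_combination (√Real.pi / 2 * q s ^ 2) * this
    simp_rw [this]
    rw [← ofReal_integral_eq_lintegral_ofReal (hq2.integrable_sq.const_mul _)
      (Filter.Eventually.of_forall fun t => by simp only [Pi.zero_apply]; positivity), integral_const_mul]
  have hI2 : ∫⁻ z : ℝ × ℝ, (∫⁻ s, k z.swap s) = ENNReal.ofReal (√Real.pi / 2 * ∫ t, q t ^ 2) := by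
    rw [← hI]
    have := lintegral_prod_swap (μ := (volume : Measure ℝ)) (ν := (volume : Measure ℝ)) (fun z => ∫⁻ s, k z s)
    exact this
  -- left side
  have hψ2 : MemLp ψ 2 := by
    rw [memLp_two_iff_integrable_sq (by fun_prop)]
    refine gauss_int.congr (Filter.Eventually.of_forall fun t => ?_)
    simp only [hψ]; rw [← Real.exp_nat_mul]; congr 1; push_cast; ring
  have iψ : Integrable (fun t => ψ t * g t) := hψ2.integrable_mul hg
  have ig : Integrable (fun t => g t ^ 2) := hg.integrable_sq
  have ip : Integrable p := gauss_int
  have eL : (fun z : ℝ × ℝ => (w z.1 - w z.2) ^ 2 * (p z.1 * p z.2)) =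
      fun z => (g z.1 ^ 2 * p z.2 + p z.1 * g z.2 ^ 2) - 2 * ((ψ z.1 * g z.1) * (ψ z.2 * g z.2)) := by
    funext z
    have hEψ : ∀ t, E t * ψ t = 1 := by
      intro t; simp only [hE, hψ]; rw [← Real.exp_add, ← Real.exp_zero]; congr 1; ring
    have hpψ : ∀ t, p t = ψ t ^ 2 := by
      intro t; simp only [hp, hψ]; rw [← Real.exp_nat_mul]; congr 1; push_cast; ring
    simp only [hw, hpψ]
    have h1 := hEψ z.1
    have h2 := hEψ z.2
    have : (g z.1 * E z.1 - g z.2 * E z.2) ^ 2 * (ψ z.1 ^ 2 * ψ z.2 ^ 2) =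
      (g z.1 * (E z.1 * ψ z.1) * ψ z.2 - g z.2 * (E z.2 * ψ z.2) * ψ z.1) ^ 2 := by ring
    rw [this, h1, h2]; ring
  have j1 : Integrable (fun z : ℝ × ℝ => g z.1 ^ 2 * p z.2) := ig.mul_prod ip
  have j2 : Integrable (fun z : ℝ × ℝ => p z.1 * g z.2 ^ 2) := ip.mul_prod ig
  have j3 : Integrable (fun z : ℝ × ℝ => (ψ z.1 * g z.1) * (ψ z.2 * g z.2)) := iψ.mul_prod iψ
  have j12 : Integrable (fun z : ℝ × ℝ => g z.1 ^ 2 * p z.2 + p z.1 * g z.2 ^ 2) := j1.add j2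
  have vL : ∫ z : ℝ × ℝ, (w z.1 - w z.2) ^ 2 * (p z.1 * p z.2) = 2 * √Real.pi * ∫ t, g t ^ 2 := by
    rw [eL, integral_sub j12 (j3.const_mul 2), integral_add j1 j2, integral_const_mul]
    have a1 := integral_prod_mul (μ := (volume : Measure ℝ)) (ν := (volume : Measure ℝ)) (fun t => g t ^ 2) p
    have a2 := integral_prod_mul (μ := (volume : Measure ℝ)) (ν := (volume : Measure ℝ)) p (fun t => g t ^ 2)
    have a3 := integral_prod_mul (μ := (volume : Measure ℝ)) (ν := (volume : Measure ℝ)) (fun t => ψ t * g t) (fun t => ψ t * g t)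
    rw [← Measure.volume_eq_prod] at a1 a2 a3
    have hpv : ∫ t, p t = √Real.pi := gauss_val
    rw [a1, a2, a3, horth, hpv]; ring
  have iL : Integrable (fun z : ℝ × ℝ => (w z.1 - w z.2) ^ 2 * (p z.1 * p z.2)) := by
    rw [eL]; exact j12.sub (j3.const_mul 2)
  have hq0 : 0 ≤ ∫ t, q t ^ 2 := integral_nonneg fun t => sq_nonneg _
  have fin : ENNReal.ofReal (2 * √Real.pi * ∫ t, g t ^ 2) ≤ ENNReal.ofReal (√Real.pi * ∫ t, q t ^ 2) := by
    rw [← vL, ofReal_integral_eq_lintegral_ofReal iL (Filter.Eventually.of_forall fun z => by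
      simp only [Pi.zero_apply]; positivity)]
    refine (lintegral_mono hle).trans ?_
    rw [lintegral_add_left (Measurable.lintegral_prod_right hkm), hI, hI2, ← ENNReal.ofReal_add (by positivity) (by positivity)]
    refine le_of_eq ?_
    congr 1; ring
  rw [ENNReal.ofReal_le_ofReal_iff (by positivity)] at fin
  have hpi : 0 < √Real.pi := Real.sqrt_pos.2 Real.pi_pos
  nlinarith


lemma ho_real_shift {g d : ℝ → ℝ} (α : ℝ) (hdm : Measurable d) (hd : MemLp d 2) (hg : MemLp g 2)
    (htg : MemLp (fun t => (t + α) * g t) 2)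
    (hf : ∀ a b, g b - g a = ∫ t in a..b, d t) :
    (∫ t, g t ^ 2) ≤ (∫ t, d t ^ 2) + (∫ t, ((t + α) * g t) ^ 2) ∧
    ((∫ t, Real.exp (-(t + α) ^ 2 / 2) * g t = 0) →
      3 * (∫ t, g t ^ 2) ≤ (∫ t, d t ^ 2) + (∫ t, ((t + α) * g t) ^ 2)) := by
  have mp : MeasurePreserving (fun t : ℝ => t - α) volume volume := measurePreserving_sub_right volume α
  have hd' : MemLp (fun t => d (t - α)) 2 := hd.comp_measurePreserving mp
  have hg' : MemLp (fun t => g (t - α)) 2 := hg.comp_measurePreserving mp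
  have htg' : MemLp (fun t => t * g (t - α)) 2 := by
    have := htg.comp_measurePreserving mp
    refine this.ae_eq (Filter.Eventually.of_forall fun t => ?_)
    simp
  have hf' : ∀ a b, g (b - α) - g (a - α) = ∫ t in a..b, d (t - α) := by
    intro a b
    rw [intervalIntegral.integral_comp_sub_right, hf]
  have A := ho_identity hd' hg' htg' hf'
  have s1 := integral_sub_right_eq_self (μ := volume) (fun t => d t ^ 2) α
  have s2 := integral_sub_right_eq_self (μ := volume) (fun t => g t ^ 2) α
  have s3 := integral_sub_right_eq_self (μ := volume) (fun t => ((t + α) * g t) ^ 2) α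
  have s4 := integral_sub_right_eq_self (μ := volume) (fun t => Real.exp (-(t + α) ^ 2 / 2) * g t) α
  simp only [sub_add_cancel] at s3 s4
  rw [s1, s2, s3] at A
  have nn : 0 ≤ ∫ t, (d (t - α) + t * g (t - α)) ^ 2 := integral_nonneg fun t => sq_nonneg _
  refine ⟨by linarith, fun h => ?_⟩
  have B := ho_poincare (hdm.comp (measurable_id.sub_const α)) hd' hg' htg' hf' (s4.trans h)
  simp only [Function.comp_apply, id] at B
  rw [s2] at B
  linarith

lemma normsq_integral {h : ℝ → ℂ} (hh : MemLp h 2) :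
    ∫ t, ‖h t‖ ^ 2 = (∫ t, (h t).re ^ 2) + ∫ t, (h t).im ^ 2 := by
  have i1 : Integrable (fun t => (h t).re ^ 2) := hh.re.integrable_sq
  have i2 : Integrable (fun t => (h t).im ^ 2) := hh.im.integrable_sq
  rw [← integral_add i1 i2]
  congr 1; funext t
  rw [Complex.sq_norm, Complex.normSq_apply]
  ring

lemma ho_complex {g d : ℝ → ℂ} (α : ℝ) (hdm : Measurable d) (hd : MemLp d 2) (hg : MemLp g 2)
    (htg : MemLp (fun t => ((t + α : ℝ) : ℂ) * g t) 2)
    (hf : ∀ a b, g b - g a = ∫ t in a..b, d t) :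
    (∫ t, ‖g t‖ ^ 2) ≤ (∫ t, ‖d t‖ ^ 2) + (∫ t, ‖((t + α : ℝ) : ℂ) * g t‖ ^ 2) ∧
    ((∫ t, ((Real.exp (-(t + α) ^ 2 / 2) : ℝ) : ℂ) * g t = 0) →
      3 * (∫ t, ‖g t‖ ^ 2) ≤ (∫ t, ‖d t‖ ^ 2) + (∫ t, ‖((t + α : ℝ) : ℂ) * g t‖ ^ 2)) := by
  have hdl : LocallyIntegrable d := hd.locallyIntegrable (by norm_num)
  have hi : ∀ a b, IntervalIntegrable d volume a b := fun a b =>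
    (hdl.integrableOn_isCompact isCompact_uIcc).intervalIntegrable
  have R := ho_real_shift (g := fun t => (g t).re) (d := fun t => (d t).re) α
    (Complex.measurable_re.comp hdm) hd.re hg.re (by simpa using htg.re) (by
      intro a b
      have := congrArg Complex.re (hf a b)
      rw [Complex.sub_re] at this
      rw [this]
      exact (Complex.reCLM.intervalIntegral_comp_comm (hi a b)).symm)
  have I := ho_real_shift (g := fun t => (g t).im) (d := fun t => (d t).im) α
    (Complex.measurable_im.comp hdm) hd.im hg.im (by simpa using htg.im) (by
      intro a b
      have := congrArg Complex.im (hf a b)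
      rw [Complex.sub_im] at this
      rw [this]
      exact (Complex.imCLM.intervalIntegral_comp_comm (hi a b)).symm)
  rw [normsq_integral hg, normsq_integral hd, normsq_integral htg]
  simp only [Complex.re_ofReal_mul, Complex.im_ofReal_mul]
  refine ⟨by linarith [R.1, I.1], fun h => ?_⟩
  have hψ : MemLp (fun t : ℝ => ((Real.exp (-(t + α) ^ 2 / 2) : ℝ) : ℂ)) 2 := by
    refine MemLp.ofReal (f := fun t : ℝ => Real.exp (-(t + α) ^ 2 / 2)) ?_
    rw [memLp_two_iff_integrable_sq (by fun_prop)]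
    refine ((gauss_int.comp_add_right α)).congr (Filter.Eventually.of_forall fun t => ?_)
    simp only; rw [← Real.exp_nat_mul]; congr 1; push_cast; ring
  have iψ : Integrable (fun t => ((Real.exp (-(t + α) ^ 2 / 2) : ℝ) : ℂ) * g t) := hψ.integrable_mul hg
  have R2 := R.2 (by
    have := congrArg Complex.re h
    have e := Complex.reCLM.integral_comp_comm iψ
    simp only [Complex.reCLM_apply, Complex.re_ofReal_mul] at e
    rw [e, this]; rfl)
  have I2 := I.2 (by
    have := congrArg Complex.im h
    have e := Complex.imCLM.integral_comp_comm iψ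
    simp only [Complex.imCLM_apply, Complex.im_ofReal_mul] at e
    rw [e, this]; rfl)
  linarith


/-- Partial Fourier coefficient in the first variable. -/
noncomputable def FC (R : ℝ) (h : ℝ × ℝ → ℂ) (k : ℤ) (y : ℝ) : ℂ :=
  (1 / R : ℂ) * ∫ x in (0:ℝ)..R, Complex.exp (-(2 * Real.pi * Complex.I * k * x / R)) * h (x, y)

lemma FC_eq {R : ℝ} (hR : 0 < R) (h : ℝ × ℝ → ℂ) (k : ℤ) (y : ℝ) :
    FC R h k y = fourierCoeffOn hR (fun x => h (x, y)) k := by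
  rw [fourierCoeffOn_eq_integral, FC]
  rw [sub_zero, Complex.real_smul]
  congr 1
  · push_cast; rfl
  · congr 1; funext x
    rw [fourier_coe_apply, smul_eq_mul]
    congr 2
    push_cast; ring

lemma parseval_slice {R : ℝ} (hR : 0 < R) (h : ℝ × ℝ → ℂ) (y : ℝ)
    (hm : AEStronglyMeasurable (fun x => h (x, y)) (volume.restrict (Set.Ioc 0 R)))
    (hfin : ∫⁻ x in Set.Ioc 0 R, ‖h (x, y)‖ₑ ^ 2 < ⊤) :
    ∫⁻ x in Set.Ioc 0 R, ‖h (x, y)‖ₑ ^ 2 = ENNReal.ofReal R * ∑' k : ℤ, ‖FC R h k y‖ₑ ^ 2 := by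
  have hL : MemLp (fun x => h (x, y)) 2 (volume.restrict (Set.Ioc 0 R)) := by
    refine ⟨hm, ?_⟩
    rw [eLpNorm_lt_top_iff_lintegral_rpow_enorm_lt_top (by norm_num) (by norm_num)]
    simpa using hfin
  have hs := hasSum_sq_fourierCoeffOn hR hL
  simp_rw [← FC_eq hR] at hs
  have hi : Integrable (fun x => ‖h (x, y)‖ ^ 2) (volume.restrict (Set.Ioc 0 R)) := hL.integrable_norm_pow (by norm_num)
  have e1 : ∫⁻ x in Set.Ioc 0 R, ‖h (x, y)‖ₑ ^ 2 = ENNReal.ofReal (∫ x in Set.Ioc 0 R, ‖h (x, y)‖ ^ 2) := by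
    rw [ofReal_integral_eq_lintegral_ofReal hi (Filter.Eventually.of_forall fun x => by
      simp only [Pi.zero_apply]; positivity)]
    congr 1; funext x
    rw [ENNReal.ofReal_pow (norm_nonneg _), ofReal_norm]
  have e2 : ∑' k : ℤ, ‖FC R h k y‖ₑ ^ 2 = ENNReal.ofReal (∑' k : ℤ, ‖FC R h k y‖ ^ 2) := by
    rw [ENNReal.ofReal_tsum_of_nonneg (fun k => by positivity) hs.summable]
    congr 1; funext x
    rw [ENNReal.ofReal_pow (norm_nonneg _), ofReal_norm]
  rw [e1, e2, hs.tsum_eq, ← ENNReal.ofReal_mul hR.le, intervalIntegral.integral_of_le hR.le]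
  congr 1
  simp only [sub_zero, smul_eq_mul]
  field_simp

lemma FC_measurable (R : ℝ) (h : ℝ × ℝ → ℂ) (hm : Measurable h) (k : ℤ) :
    Measurable (FC R h k) := by
  unfold FC
  refine Measurable.const_mul ?_ _
  simp only [intervalIntegral]
  have h1 : StronglyMeasurable (fun p : ℝ × ℝ => Complex.exp (-(2 * Real.pi * Complex.I * k * p.2 / R)) * h (p.2, p.1)) := by
    apply Measurable.stronglyMeasurable
    have : Measurable (fun p : ℝ × ℝ => h (p.2, p.1)) := hm.comp measurable_swap
    have h2 : Measurable (fun p : ℝ × ℝ => Complex.exp (-(2 * Real.pi * Complex.I * k * p.2 / R))) := by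
      apply Continuous.measurable; fun_prop
    exact h2.mul this
  exact (h1.integral_prod_right').measurable.sub (h1.integral_prod_right').measurable

/-- Quasi-periodicity in the second variable, in the gauge periodic in the first. -/
def QP (R : ℝ) (h : ℝ × ℝ → ℂ) : Prop :=
  ∀ x y, h (x, y + R) = Complex.exp (-(Complex.I * R * x)) * h (x, y)

lemma FC_shift1 {R : ℝ} {N : ℕ} (hR : 0 < R) (hq : R ^ 2 = 2 * Real.pi * N) {h : ℝ × ℝ → ℂ}
    (hQ : QP R h) (k : ℤ) (y : ℝ) : FC R h (k + N) y = FC R h k (y + R) := by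
  unfold FC
  congr 2; funext x
  rw [hQ x y, ← mul_assoc, ← Complex.exp_add]
  congr 2
  have hR' : (R : ℂ) ≠ 0 := by exact_mod_cast hR.ne'
  have hq' : (R : ℂ) ^ 2 = 2 * Real.pi * N := by exact_mod_cast hq
  push_cast
  field_simp
  linear_combination x * hq'

lemma FC_shift {R : ℝ} {N : ℕ} (hR : 0 < R) (hq : R ^ 2 = 2 * Real.pi * N) {h : ℝ × ℝ → ℂ}
    (hQ : QP R h) (m k : ℤ) (y : ℝ) : FC R h (k + N * m) y = FC R h k (y + m * R) := by
  induction m using Int.induction_on generalizing k y with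
  | zero => simp
  | succ i ih =>
    have := ih (k + N) y
    rw [FC_shift1 hR hq hQ] at this
    rw [show k + (N:ℤ) * ((i:ℤ) + 1) = k + N + N * i by ring, this]
    congr 1; push_cast; ring
  | pred i ih =>
    have := ih (k - N) y
    rw [show k + (N:ℤ) * (-(i:ℤ) - 1) = k - N + N * -i by ring, this]
    have h2 := FC_shift1 hR hq hQ (k - N) (y + ((-(i:ℤ) - 1 : ℤ) : ℝ) * R)
    rw [sub_add_cancel] at h2
    rw [h2]; congr 1; push_cast; ring

lemma lintegral_periodize {R : ℝ} (hR : 0 < R) (F : ℝ → ENNReal) :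
    ∫⁻ y, F y = ∑' m : ℤ, ∫⁻ y in Set.Ioc 0 R, F (y + m * R) := by
  rw [← setLIntegral_univ, ← iUnion_Ioc_zsmul hR, lintegral_iUnion (fun _ => measurableSet_Ioc)
    (Set.pairwise_disjoint_Ioc_zsmul R)]
  congr 1; funext m
  have := (measurePreserving_add_right volume ((m:ℝ) * R)).setLIntegral_comp_emb
    (measurableEmbedding_addRight ((m:ℝ)*R)) F (Set.Ioc 0 R)
  rw [this]
  simp
  congr 2
  ring_nf

lemma parseval2 {R : ℝ} {N : ℕ} (hN : 0 < N) (hR : 0 < R) (hq : R ^ 2 = 2 * Real.pi * N)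
    {h : ℝ × ℝ → ℂ} (hQ : QP R h) (hm : Measurable h)
    (hfin : ∫⁻ z in KR R, ‖h z‖ₑ ^ 2 < ⊤) :
    ∫⁻ z in KR R, ‖h z‖ₑ ^ 2 = ENNReal.ofReal R * ∑ j : Fin N, ∫⁻ y, ‖FC R h (j : ℕ) y‖ₑ ^ 2 := by
  have e0 : ∫⁻ z in KR R, ‖h z‖ₑ ^ 2 = ∫⁻ y in Set.Ioc 0 R, ∫⁻ x in Set.Ioc 0 R, ‖h (x, y)‖ₑ ^ 2 := by
    rw [KR, Measure.volume_eq_prod, ← Measure.prod_restrict, Measure.restrict_congr_set Ioo_ae_eq_Ioc,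
      lintegral_prod_symm _ (by fun_prop)]
  have ae : ∀ᵐ y ∂(volume.restrict (Set.Ioc 0 R)), ∫⁻ x in Set.Ioc 0 R, ‖h (x, y)‖ₑ ^ 2 < ⊤ := by
    refine ae_lt_top ?_ (by rw [← e0]; exact hfin.ne)
    exact Measurable.lintegral_prod_left' (f := fun z => ‖h z‖ₑ ^ 2) (by fun_prop)
  rw [e0]
  have e1 : ∫⁻ y in Set.Ioc 0 R, ∫⁻ x in Set.Ioc 0 R, ‖h (x, y)‖ₑ ^ 2 =
      ∫⁻ y in Set.Ioc 0 R, ENNReal.ofReal R * ∑' k : ℤ, ‖FC R h k y‖ₑ ^ 2 := by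
    apply lintegral_congr_ae
    filter_upwards [ae] with y hy
    refine parseval_slice hR h y ?_ hy
    exact (hm.comp (measurable_id.prodMk measurable_const)).aestronglyMeasurable
  have hFm := FC_measurable R h hm
  rw [e1, lintegral_const_mul _ (Measurable.tsum fun k => (hFm k).enorm.pow_const 2),
    lintegral_tsum (fun k => ((hFm k).enorm.pow_const 2).aemeasurable)]
  congr 1
  have : NeZero N := ⟨hN.ne'⟩
  rw [← (Int.divModEquiv N).symm.tsum_eq, ENNReal.tsum_prod', ENNReal.tsum_comm, tsum_fintype]
  congr 1; funext j
  rw [lintegral_periodize hR]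
  congr 1; funext m
  congr 1; funext y
  rw [← FC_shift hR hq hQ]
  simp [Int.divModEquiv]
  congr 3
  try ring

lemma parseval_real {R : ℝ} {N : ℕ} (hN : 0 < N) (hR : 0 < R) (hq : R ^ 2 = 2 * Real.pi * N)
    {h : ℝ × ℝ → ℂ} (hQ : QP R h) (hm : Measurable h)
    (hi : IntegrableOn (fun z => ‖h z‖ ^ 2) (KR R)) :
    (∀ j : Fin N, MemLp (FC R h (j : ℕ)) 2) ∧
    ∫ z in KR R, ‖h z‖ ^ 2 = R * ∑ j : Fin N, ∫ y, ‖FC R h (j : ℕ) y‖ ^ 2 := by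
  have key : ∀ {α : Type} [MeasurableSpace α] (μ : Measure α) (φ : α → ℂ),
      ∫⁻ z, ‖φ z‖ₑ ^ 2 ∂μ = ∫⁻ z, ENNReal.ofReal (‖φ z‖ ^ 2) ∂μ := by
    intro α _ μ φ
    congr 1; funext x
    rw [ENNReal.ofReal_pow (norm_nonneg _), ofReal_norm]
  have nn : ∀ {α : Type} [MeasurableSpace α] (μ : Measure α) (φ : α → ℂ),
      0 ≤ᵐ[μ] fun z => ‖φ z‖ ^ 2 := fun μ φ => Filter.Eventually.of_forall fun x => by
      simp only [Pi.zero_apply]; positivity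
  have e1 : ∫⁻ z in KR R, ‖h z‖ₑ ^ 2 = ENNReal.ofReal (∫ z in KR R, ‖h z‖ ^ 2) := by
    rw [ofReal_integral_eq_lintegral_ofReal hi (nn _ _), key]
  have hfin : ∫⁻ z in KR R, ‖h z‖ₑ ^ 2 < ⊤ := by rw [e1]; exact ENNReal.ofReal_lt_top
  have P := parseval2 hN hR hq hQ hm hfin
  have hRpos : ENNReal.ofReal R ≠ 0 := by simpa using hR
  have sfin : ∑ j : Fin N, ∫⁻ y, ‖FC R h (j : ℕ) y‖ₑ ^ 2 < ⊤ := by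
    by_contra hcon
    rw [not_lt_top_iff] at hcon
    rw [hcon, ENNReal.mul_top hRpos] at P
    exact hfin.ne P
  have hL : ∀ j : Fin N, MemLp (FC R h (j : ℕ)) 2 := by
    intro j
    refine ⟨(FC_measurable R h hm _).aestronglyMeasurable, ?_⟩
    rw [eLpNorm_lt_top_iff_lintegral_rpow_enorm_lt_top (by norm_num) (by norm_num)]
    simpa using (ENNReal.sum_lt_top.1 sfin) j (Finset.mem_univ j)
  refine ⟨hL, ?_⟩
  have e2 : ∀ j : Fin N, ∫⁻ y, ‖FC R h (j : ℕ) y‖ₑ ^ 2 = ENNReal.ofReal (∫ y, ‖FC R h (j : ℕ) y‖ ^ 2) := by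
    intro j
    rw [ofReal_integral_eq_lintegral_ofReal ((hL j).integrable_norm_pow (by norm_num)) (nn _ _), key]
  simp_rw [e1, e2] at P
  rw [← ENNReal.ofReal_sum_of_nonneg (fun j _ => integral_nonneg fun y => by positivity),
    ← ENNReal.ofReal_mul hR.le, ENNReal.ofReal_eq_ofReal_iff (integral_nonneg fun y => by positivity)
    (mul_nonneg hR.le (Finset.sum_nonneg fun j _ => integral_nonneg fun y => by positivity))] at P
  exact P


/-- The gauge factor. -/
noncomputable def gf (z : ℝ × ℝ) : ℂ := Complex.exp (-(Complex.I * z.1 * z.2 / 2))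

lemma gf_norm (z : ℝ × ℝ) : ‖gf z‖ = 1 := by
  have : gf z = Complex.exp (((-(z.1 * z.2 / 2) : ℝ) : ℂ) * Complex.I) := by
    unfold gf; congr 1; push_cast; ring
  rw [this, Complex.norm_exp_ofReal_mul_I]

lemma gf_hasFDerivAt (z : ℝ × ℝ) : HasFDerivAt gf
    ((-(Complex.I / 2) * gf z) • (((z.1 : ℝ) : ℂ) • (Complex.ofRealCLM.comp (ContinuousLinearMap.snd ℝ ℝ ℝ)) +
      ((z.2 : ℝ) : ℂ) • (Complex.ofRealCLM.comp (ContinuousLinearMap.fst ℝ ℝ ℝ)))) z := by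
  have h1 : HasFDerivAt (fun z : ℝ × ℝ => (z.1 : ℂ)) (Complex.ofRealCLM.comp (ContinuousLinearMap.fst ℝ ℝ ℝ)) z :=
    (Complex.ofRealCLM.comp (ContinuousLinearMap.fst ℝ ℝ ℝ)).hasFDerivAt
  have h2 : HasFDerivAt (fun z : ℝ × ℝ => (z.2 : ℂ)) (Complex.ofRealCLM.comp (ContinuousLinearMap.snd ℝ ℝ ℝ)) z :=
    (Complex.ofRealCLM.comp (ContinuousLinearMap.snd ℝ ℝ ℝ)).hasFDerivAt
  have h3 := ((h1.mul h2).const_mul (-(Complex.I / 2))).cexp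
  have e : gf = fun z : ℝ × ℝ => Complex.exp (-(Complex.I / 2) * ((z.1 : ℂ) * z.2)) := by
    funext z; unfold gf; congr 1; ring
  rw [e]
  refine h3.congr_fderiv ?_
  ext <;> simp <;> ring

/-- The gauge transformed function. -/
noncomputable def gv (f : ℝ × ℝ → ℂ) (z : ℝ × ℝ) : ℂ := gf z * f z
noncomputable def gV1 (f : ℝ × ℝ → ℂ) (z : ℝ × ℝ) : ℂ := gf z * mg1 f z
noncomputable def gV2 (f : ℝ × ℝ → ℂ) (z : ℝ × ℝ) : ℂ := gf z * mg2 f z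

lemma gv_diff {f : ℝ × ℝ → ℂ} (hf : Differentiable ℝ f) : Differentiable ℝ (gv f) := fun z =>
  (gf_hasFDerivAt z).differentiableAt.mul (hf z)

lemma gv_fderiv {f : ℝ × ℝ → ℂ} (hf : Differentiable ℝ f) (z : ℝ × ℝ) :
    fderiv ℝ (gv f) z (1, 0) = gV1 f z - Complex.I * z.2 * gv f z ∧
    fderiv ℝ (gv f) z (0, 1) = gV2 f z := by
  have h : HasFDerivAt (gv f) _ z := (gf_hasFDerivAt z).mul (hf z).hasFDerivAt
  rw [h.fderiv]
  simp only [gV1, gV2, mg1, mg2, A0, gv]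
  constructor
  · simp; ring
  · simp; ring

lemma gf_meas : Measurable gf := by
  have : Continuous gf := by unfold gf; fun_prop
  exact this.measurable

lemma mg1_meas {f : ℝ × ℝ → ℂ} (hf : Differentiable ℝ f) : Measurable (mg1 f) := by
  have h := measurable_fderiv_apply_const ℝ f (1, 0)
  have h2 := hf.continuous.measurable
  unfold mg1
  refine h.sub (Measurable.mul ?_ h2)
  apply Continuous.measurable; unfold A0; fun_prop

lemma mg2_meas {f : ℝ × ℝ → ℂ} (hf : Differentiable ℝ f) : Measurable (mg2 f) := by
  have h := measurable_fderiv_apply_const ℝ f (0, 1)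
  have h2 := hf.continuous.measurable
  unfold mg2
  refine h.sub (Measurable.mul ?_ h2)
  apply Continuous.measurable; unfold A0; fun_prop

lemma per_phase {R : ℝ} {N : ℕ} (hR : 0 < R) (hq : R ^ 2 = 2 * Real.pi * N) (t : ℝ) :
    ((Real.pi * N * t / R : ℝ) : ℂ) = R * t / 2 := by
  have h : Real.pi * N * t / R = R * t / 2 := by
    field_simp
    linear_combination (-t) * hq
  rw [h]; push_cast; ring

lemma inER_iff {R : ℝ} {N : ℕ} (hR : 0 < R) (hq : R ^ 2 = 2 * Real.pi * N) {f : ℝ × ℝ → ℂ} :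
    inER R N f ↔ (∀ x y, gv f (x + R, y) = gv f (x, y)) ∧ QP R (gv f) := by
  unfold inER QP gv
  simp_rw [per_phase hR hq]
  have ne : ∀ z, gf z ≠ 0 := fun z => Complex.exp_ne_zero _
  have e1 : ∀ x y : ℝ, gf (x, y) = gf (x + R, y) * Complex.exp (Complex.I * (R * y / 2)) := by
    intro x y; unfold gf; rw [← Complex.exp_add]; congr 1; push_cast; ring
  have e2 : ∀ x y : ℝ, Complex.exp (-(Complex.I * R * x)) * gf (x, y) = gf (x, y + R) * Complex.exp (-(Complex.I * (R * x / 2))) := by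
    intro x y; unfold gf; rw [← Complex.exp_add, ← Complex.exp_add]; congr 1; push_cast; ring
  constructor
  · rintro ⟨h1, h2⟩
    refine ⟨fun x y => ?_, fun x y => ?_⟩
    · rw [h1 (x, y), e1 x y]; ring
    · rw [h2 (x, y), ← mul_assoc, ← mul_assoc, e2]
  · rintro ⟨h1, h2⟩
    refine ⟨fun ⟨x, y⟩ => ?_, fun ⟨x, y⟩ => ?_⟩
    · have := h1 x y
      rw [e1 x y, mul_assoc] at this
      exact mul_left_cancel₀ (ne _) this
    · have := h2 x y
      rw [← mul_assoc, e2, mul_assoc] at this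
      exact mul_left_cancel₀ (ne _) this

lemma V_QP {R : ℝ} {f : ℝ × ℝ → ℂ} (hf : Differentiable ℝ f) (hQ : QP R (gv f)) :
    QP R (gV1 f) ∧ QP R (gV2 f) := by
  have hv := gv_diff hf
  have key : ∀ z : ℝ × ℝ, fderiv ℝ (gv f) (z + (0, R)) =
      Complex.exp (-(Complex.I * R * z.1)) • fderiv ℝ (gv f) z +
      gv f z • ((-(Complex.I * R) * Complex.exp (-(Complex.I * R * z.1))) • (Complex.ofRealCLM.comp (ContinuousLinearMap.fst ℝ ℝ ℝ))) := by
    intro z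
    rw [← fderiv_comp_add_right]
    have e : (fun z => gv f (z + (0, R))) = fun z => Complex.exp (-(Complex.I * R * z.1)) * gv f z := by
      funext z
      have hz : z + (0, R) = (z.1, z.2 + R) := by ext <;> simp
      rw [hz]
      exact hQ z.1 z.2
    rw [e]
    have h1 : HasFDerivAt (fun z : ℝ × ℝ => (z.1 : ℂ)) (Complex.ofRealCLM.comp (ContinuousLinearMap.fst ℝ ℝ ℝ)) z :=
      (Complex.ofRealCLM.comp (ContinuousLinearMap.fst ℝ ℝ ℝ)).hasFDerivAt
    have h3 : HasFDerivAt (fun z : ℝ × ℝ => Complex.exp (-(Complex.I * R * z.1))) _ z :=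
      ((h1.const_mul (Complex.I * R)).neg).cexp
    have h4 : HasFDerivAt (fun z : ℝ × ℝ => Complex.exp (-(Complex.I * R * z.1)) * gv f z) _ z :=
      h3.mul (hv z).hasFDerivAt
    rw [h4.fderiv]
    ext
    · simp; left; ring
    · simp
  constructor
  · intro x y
    have h1 := (gv_fderiv hf (x, y + R)).1
    have h2 := (gv_fderiv hf (x, y)).1
    have k := congrArg (fun L => L (1, 0)) (key (x, y))
    simp only [Prod.mk_add_mk, add_zero] at k
    rw [h1] at k
    simp [h2, hQ x y] at k
    simp at h1 h2
    linear_combination k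
  · intro x y
    have h1 := (gv_fderiv hf (x, y + R)).2
    have h2 := (gv_fderiv hf (x, y)).2
    have k := congrArg (fun L => L (0, 1)) (key (x, y))
    simp only [Prod.mk_add_mk, add_zero] at k
    rw [h1] at k
    simp [h2] at k
    exact k


lemma gv_norm (f z) : ‖gv f z‖ = ‖f z‖ := by simp [gv, gf_norm]
lemma gV1_norm (f z) : ‖gV1 f z‖ = ‖mg1 f z‖ := by simp [gV1, gf_norm]
lemma gV2_norm (f z) : ‖gV2 f z‖ = ‖mg2 f z‖ := by simp [gV2, gf_norm]

lemma gV1_meas {f : ℝ × ℝ → ℂ} (hf : Differentiable ℝ f) : Measurable (gV1 f) := gf_meas.mul (mg1_meas hf)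
lemma gV2_meas {f : ℝ × ℝ → ℂ} (hf : Differentiable ℝ f) : Measurable (gV2 f) := gf_meas.mul (mg2_meas hf)
lemma gv_meas {f : ℝ × ℝ → ℂ} (hf : Differentiable ℝ f) : Measurable (gv f) := (gv_diff hf).continuous.measurable

lemma KR_finite (R : ℝ) : volume (KR R) < ⊤ := by
  rw [KR, Measure.volume_eq_prod, Measure.prod_prod]
  simp [ENNReal.mul_lt_top]

lemma sq_int_of_sum {f : ℝ × ℝ → ℂ} {R : ℝ} (hf : Differentiable ℝ f)
    (hi : IntegrableOn (fun x => ‖mg1 f x‖ ^ 2 + ‖mg2 f x‖ ^ 2) (KR R)) :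
    IntegrableOn (fun z => ‖gV1 f z‖ ^ 2) (KR R) ∧ IntegrableOn (fun z => ‖gV2 f z‖ ^ 2) (KR R) := by
  constructor
  · refine hi.mono' ((gV1_meas hf).norm.pow_const 2).aestronglyMeasurable (Filter.Eventually.of_forall fun z => ?_)
    rw [gV1_norm, Real.norm_of_nonneg (by positivity)]
    nlinarith [sq_nonneg ‖mg2 f z‖]
  · refine hi.mono' ((gV2_meas hf).norm.pow_const 2).aestronglyMeasurable (Filter.Eventually.of_forall fun z => ?_)
    rw [gV2_norm, Real.norm_of_nonneg (by positivity)]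
    nlinarith [sq_nonneg ‖mg1 f z‖]

lemma int_of_sq {h : ℝ × ℝ → ℂ} {R : ℝ} (hm : Measurable h)
    (hi : IntegrableOn (fun z => ‖h z‖ ^ 2) (KR R)) :
    Integrable h ((volume.restrict (Set.Ioc 0 R)).prod (volume.restrict (Set.Ioc 0 R))) := by
  have : (volume.restrict (Set.Ioc (0:ℝ) R)).prod (volume.restrict (Set.Ioc (0:ℝ) R)) = (volume : Measure (ℝ × ℝ)).restrict (KR R) := by
    rw [KR, Measure.volume_eq_prod, ← Measure.prod_restrict, Measure.restrict_congr_set Ioo_ae_eq_Ioc]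
  rw [this]
  have hfin := KR_finite R
  have : IsFiniteMeasure ((volume : Measure (ℝ × ℝ)).restrict (KR R)) := ⟨by simpa using hfin⟩
  have := (memLp_two_iff_integrable_sq_norm hm.aestronglyMeasurable).2 hi
  exact this.integrable (by norm_num)

lemma FC_V1_slice {f : ℝ × ℝ → ℂ} {R : ℝ} (hR : 0 < R) (hf : Differentiable ℝ f)
    (hp : ∀ x y, gv f (x + R, y) = gv f (x, y)) (y : ℝ)
    (hi : IntegrableOn (fun x => gV1 f (x, y)) (Set.Ioc 0 R)) (k : ℤ) :
    FC R (gV1 f) k y = Complex.I * ((y + 2 * Real.pi * k / R : ℝ) : ℂ) * FC R (gv f) k y := by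
  have hR' : (R : ℂ) ≠ 0 := by exact_mod_cast hR.ne'
  have hv := gv_diff hf
  set e : ℝ → ℂ := fun x => Complex.exp (-(2 * Real.pi * Complex.I * k * x / R)) with he
  have hec : Continuous e := by rw [he]; fun_prop
  have hvc : Continuous (fun x => gv f (x, y)) := hv.continuous.comp (by fun_prop)
  have i1 : IntervalIntegrable (fun x => e x * gV1 f (x, y)) volume 0 R := by
    rw [intervalIntegrable_iff_integrableOn_Ioc_of_le hR.le]
    have : IntervalIntegrable (fun x => gV1 f (x, y)) volume 0 R := by
      rwa [intervalIntegrable_iff_integrableOn_Ioc_of_le hR.le]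
    have := this.continuousOn_mul hec.continuousOn
    rwa [intervalIntegrable_iff_integrableOn_Ioc_of_le hR.le] at this
  have i2 : IntervalIntegrable (fun x => e x * gv f (x, y)) volume 0 R :=
    (hec.mul hvc).intervalIntegrable _ _
  have hd : ∀ x : ℝ, HasDerivAt (fun x => e x * gv f (x, y))
      (e x * gV1 f (x, y) - Complex.I * ((y + 2 * Real.pi * k / R : ℝ) : ℂ) * (e x * gv f (x, y))) x := by
    intro x
    have h1 : HasDerivAt (fun x : ℝ => gv f (x, y)) (gV1 f (x, y) - Complex.I * y * gv f (x, y)) x := by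
      have h0 : HasDerivAt (fun x : ℝ => (x, y)) ((1 : ℝ), (0 : ℝ)) x := (hasDerivAt_id x).prodMk (hasDerivAt_const x y)
      have := (hv (x, y)).hasFDerivAt.comp_hasDerivAt x h0
      rwa [(gv_fderiv hf (x, y)).1] at this
    have h2 : HasDerivAt e (e x * (-(2 * Real.pi * Complex.I * k / R))) x := by
      have h0 : HasDerivAt (fun x : ℝ => (x : ℂ)) 1 x := Complex.ofRealCLM.hasDerivAt
      have := (((h0.const_mul (2 * Real.pi * Complex.I * k)).div_const (R:ℂ)).neg).cexp
      simpa using this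
    refine (h2.mul h1).congr_deriv ?_
    push_cast; ring
  have ftc := intervalIntegral.integral_eq_sub_of_hasDerivAt (a := 0) (b := R) (fun x _ => hd x)
    (i1.sub (i2.const_mul _))
  have z0 : e R * gv f (R, y) - e 0 * gv f (0, y) = 0 := by
    have := hp 0 y
    rw [zero_add] at this
    rw [this]
    have h1 : e R = 1 := by
      rw [he]; simp only
      rw [show -(2 * (Real.pi:ℂ) * Complex.I * k * R / R) = ((-k : ℤ) : ℂ) * (2 * Real.pi * Complex.I) by
        push_cast; field_simp]
      exact Complex.exp_int_mul_two_pi_mul_I _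
    have h2 : e 0 = 1 := by simp [he]
    rw [h1, h2]; ring
  rw [z0, intervalIntegral.integral_sub i1 (i2.const_mul _), intervalIntegral.integral_const_mul] at ftc
  unfold FC
  change _ * (∫ x in (0:ℝ)..R, e x * gV1 f (x, y)) = _ * (_ * ∫ x in (0:ℝ)..R, e x * gv f (x, y))
  linear_combination (1 / R : ℂ) * ftc

lemma ae_of_cells {R : ℝ} (hR : 0 < R) {P : ℝ → Prop}
    (h : ∀ m : ℤ, ∀ᵐ y ∂(volume.restrict (Set.Ioc 0 R)), P (y + m * R)) : ∀ᵐ y, P y := by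
  have h2 : ∀ m : ℤ, ∀ᵐ y ∂volume, y ∈ Set.Ioc 0 R → P (y + m * R) := fun m =>
    (ae_restrict_iff' measurableSet_Ioc).1 (h m)
  have h3 : ∀ m : ℤ, ∀ᵐ y ∂volume, y - m * R ∈ Set.Ioc 0 R → P y := by
    intro m
    have := (measurePreserving_sub_right volume ((m:ℝ) * R)).quasiMeasurePreserving.ae (h2 m)
    simpa using this
  filter_upwards [ae_all_iff.2 h3] with y hy
  have : y ∈ ⋃ n : ℤ, Set.Ioc (n • R) ((n + 1) • R) := by rw [iUnion_Ioc_zsmul hR]; trivial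
  obtain ⟨n, hn⟩ := Set.mem_iUnion.1 this
  refine hy n ?_
  simp only [Set.mem_Ioc, zsmul_eq_mul] at hn ⊢
  push_cast at hn
  constructor <;> linarith [hn.1, hn.2]

lemma FC_V1 {f : ℝ × ℝ → ℂ} {R : ℝ} {N : ℕ} (hR : 0 < R) (hq : R ^ 2 = 2 * Real.pi * N) (hf : Differentiable ℝ f)
    (hp : ∀ x y, gv f (x + R, y) = gv f (x, y)) (hQ : QP R (gv f))
    (hi : IntegrableOn (fun z => ‖gV1 f z‖ ^ 2) (KR R)) (k : ℤ) :
    ∀ᵐ y, FC R (gV1 f) k y = Complex.I * ((y + 2 * Real.pi * k / R : ℝ) : ℂ) * FC R (gv f) k y := by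
  have i := int_of_sq (gV1_meas hf) hi
  have h1 := i.prod_left_ae
  apply ae_of_cells hR
  intro m
  filter_upwards [h1] with y hy
  rw [← FC_shift hR hq hQ, ← FC_shift hR hq (V_QP hf hQ).1, FC_V1_slice hR hf hp y hy]
  congr 3
  push_cast
  have : (2 * Real.pi * (k + N * m) / R : ℝ) = 2 * Real.pi * k / R + m * R := by
    field_simp
    linear_combination (-m : ℝ) * hq
  rw [this]; ring

lemma FC_V2_cell {f : ℝ × ℝ → ℂ} {R : ℝ} (hR : 0 < R) (hf : Differentiable ℝ f)
    (hi : IntegrableOn (fun z => ‖gV2 f z‖ ^ 2) (KR R)) (k : ℤ) (y : ℝ) (hy : y ∈ Set.Icc 0 R) :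
    FC R (gv f) k y - FC R (gv f) k 0 = ∫ t in (0:ℝ)..y, FC R (gV2 f) k t := by
  have i := int_of_sq (gV2_meas hf) hi
  have hv := gv_diff hf
  set e : ℝ → ℂ := fun x => Complex.exp (-(2 * Real.pi * Complex.I * k * x / R)) with he
  have hec : Continuous e := by rw [he]; fun_prop
  have hvc : ∀ y, Continuous (fun x => gv f (x, y)) := fun y => hv.continuous.comp (by fun_prop)
  have i2 : ∀ y, IntervalIntegrable (fun x => e x * gv f (x, y)) volume 0 R := fun y =>
    (hec.mul (hvc y)).intervalIntegrable _ _
  have ie : Integrable (fun z : ℝ × ℝ => e z.1 * gV2 f z)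
      ((volume.restrict (Set.Ioc 0 R)).prod (volume.restrict (Set.Ioc 0 R))) := by
    refine i.mono (((hec.measurable.comp measurable_fst).mul (gV2_meas hf)).aestronglyMeasurable) (Filter.Eventually.of_forall fun z => ?_)
    have : ‖e z.1‖ = 1 := by
      rw [he]; simp only
      rw [show -(2 * (Real.pi:ℂ) * Complex.I * k * z.1 / R) = ((-(2 * Real.pi * k * z.1 / R) : ℝ) : ℂ) * Complex.I by
        push_cast; ring, Complex.norm_exp_ofReal_mul_I]
    simp [this]
  have ie2 : Integrable (fun z : ℝ × ℝ => e z.1 * gV2 f z)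
      ((volume.restrict (Set.Ioc 0 R)).prod (volume.restrict (Set.Ioc 0 y))) := by
    refine ie.mono_measure ?_
    exact Measure.prod_mono le_rfl (Measure.restrict_mono (Set.Ioc_subset_Ioc_right hy.2) le_rfl)
  have sw := integral_integral_swap (f := fun x t => e x * gV2 f (x, t)) ie2
  unfold FC
  rw [intervalIntegral.integral_const_mul, ← mul_sub]
  congr 1
  change (∫ x in (0:ℝ)..R, e x * gv f (x, y)) - (∫ x in (0:ℝ)..R, e x * gv f (x, 0)) = _
  rw [← intervalIntegral.integral_sub (i2 _) (i2 _)]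
  simp only [intervalIntegral.integral_of_le hR.le, intervalIntegral.integral_of_le hy.1]
  rw [← sw]
  apply integral_congr_ae
  filter_upwards [ie2.prod_right_ae] with x hx
  have hne : e x ≠ 0 := Complex.exp_ne_zero _
  have hd : ∀ t : ℝ, HasDerivAt (fun t => e x * gv f (x, t)) (e x * gV2 f (x, t)) t := by
    intro t
    have h0 : HasDerivAt (fun t : ℝ => (x, t)) ((0 : ℝ), (1 : ℝ)) t := (hasDerivAt_const t x).prodMk (hasDerivAt_id t)
    have := (hv (x, t)).hasFDerivAt.comp_hasDerivAt t h0
    rw [(gv_fderiv hf (x, t)).2] at this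
    exact this.const_mul _
  rw [← intervalIntegral.integral_of_le hy.1]
  rw [intervalIntegral.integral_eq_sub_of_hasDerivAt (fun t _ => hd t)]
  rw [intervalIntegrable_iff_integrableOn_Ioc_of_le hy.1]
  exact hx

lemma cell_to_global {R : ℝ} (hR : 0 < R) {g d : ℝ → ℂ} (hd : ∀ a b, IntervalIntegrable d volume a b)
    (h : ∀ m : ℤ, ∀ y ∈ Set.Icc 0 R, g (y + m * R) - g (m * R) = ∫ t in (m * R : ℝ)..(y + m * R), d t) :
    ∀ a b, g b - g a = ∫ t in a..b, d t := by
  -- G(y) = g y - ∫_0^y d is constant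
  have hZ : ∀ m : ℤ, g (m * R) - g 0 = ∫ t in (0:ℝ)..(m * R), d t := by
    intro m
    induction m using Int.induction_on with
    | zero => simp
    | succ i ih =>
      have := h i R ⟨hR.le, le_rfl⟩
      rw [← intervalIntegral.integral_add_adjacent_intervals (hd 0 (((i:ℤ):ℝ) * R)) (hd _ _), ← ih]
      have e : (((i:ℤ) + 1 : ℤ) : ℝ) * R = R + ((i:ℤ):ℝ) * R := by push_cast; ring
      rw [e, ← this]; ring
    | pred i ih =>
      have := h (-(i:ℤ) - 1) R ⟨hR.le, le_rfl⟩
      have e : R + ((-(i:ℤ) - 1 : ℤ) : ℝ) * R = ((-(i:ℤ) : ℤ) : ℝ) * R := by push_cast; ring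
      rw [e] at this
      have e2 := intervalIntegral.integral_add_adjacent_intervals (hd 0 (((-(i:ℤ) - 1 : ℤ) : ℝ) * R)) (hd _ (((-(i:ℤ) : ℤ) : ℝ) * R))
      rw [← ih, ← this] at e2
      linear_combination -e2
  have hY : ∀ y, g y - g 0 = ∫ t in (0:ℝ)..y, d t := by
    intro y
    have : y ∈ ⋃ n : ℤ, Set.Ioc (n • R) ((n + 1) • R) := by rw [iUnion_Ioc_zsmul hR]; trivial
    obtain ⟨n, hn⟩ := Set.mem_iUnion.1 this
    simp only [Set.mem_Ioc, zsmul_eq_mul] at hn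
    push_cast at hn
    have := h n (y - n * R) ⟨by linarith [hn.1], by linarith [hn.2]⟩
    rw [sub_add_cancel] at this
    rw [← intervalIntegral.integral_add_adjacent_intervals (hd 0 ((n:ℝ) * R)) (hd _ _), ← this, ← hZ]
    ring
  intro a b
  rw [← intervalIntegral.integral_interval_sub_left (hd 0 b) (hd 0 a), ← hY, ← hY]
  ring

lemma FC_prim {f : ℝ × ℝ → ℂ} {R : ℝ} {N : ℕ} (hR : 0 < R) (hq : R ^ 2 = 2 * Real.pi * N) (hf : Differentiable ℝ f)
    (hQ : QP R (gv f))
    (hi : IntegrableOn (fun z => ‖gV2 f z‖ ^ 2) (KR R)) (k : ℤ) (hL : MemLp (FC R (gV2 f) k) 2) :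
    ∀ a b, FC R (gv f) k b - FC R (gv f) k a = ∫ t in a..b, FC R (gV2 f) k t := by
  have hdl : LocallyIntegrable (FC R (gV2 f) k) := hL.locallyIntegrable (by norm_num)
  refine cell_to_global hR (fun a b =>
    (hdl.integrableOn_isCompact isCompact_uIcc).intervalIntegrable) ?_
  intro m y hy
  have h1 := FC_V2_cell hR hf hi (k + N * m) y hy
  rw [FC_shift hR hq hQ, FC_shift hR hq hQ, zero_add] at h1
  rw [h1]
  simp_rw [FC_shift hR hq (V_QP hf hQ).2]
  rw [intervalIntegral.integral_comp_add_right (fun t => FC R (gV2 f) k t), zero_add]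

theorem main_ineq {f : ℝ × ℝ → ℂ} {R : ℝ} {N : ℕ} (hN : 0 < N) (hR : 0 < R) (hq : R ^ 2 = 2 * Real.pi * N)
    (hf : Differentiable ℝ f) (hE : inER R N f)
    (h0 : IntegrableOn (fun x => ‖f x‖ ^ 2) (KR R))
    (hi : IntegrableOn (fun x => ‖mg1 f x‖ ^ 2 + ‖mg2 f x‖ ^ 2) (KR R)) :
    (∫ x in KR R, ‖f x‖ ^ 2) ≤ QR R f ∧
    ((∀ j : Fin N, ∫ t, ((Real.exp (-(t + 2 * Real.pi * (j : ℕ) / R) ^ 2 / 2) : ℝ) : ℂ) * FC R (gv f) (j : ℕ) t = 0) →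
      3 * (∫ x in KR R, ‖f x‖ ^ 2) ≤ QR R f) := by
  obtain ⟨hp, hQ⟩ := (inER_iff hR hq).1 hE
  obtain ⟨i1, i2⟩ := sq_int_of_sum hf hi
  have i0 : IntegrableOn (fun x => ‖gv f x‖ ^ 2) (KR R) := by simpa only [gv_norm] using h0
  obtain ⟨L0, P0⟩ := parseval_real hN hR hq hQ (gv_meas hf) i0
  obtain ⟨L1, P1⟩ := parseval_real hN hR hq (V_QP hf hQ).1 (gV1_meas hf) i1
  obtain ⟨L2, P2⟩ := parseval_real hN hR hq (V_QP hf hQ).2 (gV2_meas hf) i2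
  have hQR : QR R f = R * ∑ j : Fin N, ((∫ y, ‖FC R (gV2 f) (j : ℕ) y‖ ^ 2) + ∫ y, ‖FC R (gV1 f) (j : ℕ) y‖ ^ 2) := by
    rw [Finset.sum_add_distrib, mul_add, ← P1, ← P2, QR]
    simp_rw [gV1_norm, gV2_norm]
    simp_rw [gV1_norm] at i1
    simp_rw [gV2_norm] at i2
    rw [integral_add i1 i2, add_comm]
  have key : ∀ j : Fin N, _ := fun j => ho_complex (g := FC R (gv f) (j : ℕ)) (d := FC R (gV2 f) (j : ℕ))
      (2 * Real.pi * (j : ℕ) / R) (FC_measurable R _ (gV2_meas hf) _) (L2 j) (L0 j)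
      (by
        refine ((L1 j).const_mul (-Complex.I)).ae_eq ?_
        filter_upwards [FC_V1 hR hq hf hp hQ i1 (j : ℕ)] with y hy
        rw [hy]; push_cast
        linear_combination (-((y:ℂ) + 2 * Real.pi * (j:ℕ) / R) * FC R (gv f) (j:ℕ) y) * Complex.I_sq)
      (FC_prim hR hq hf hQ i2 _ (L2 j))
  have e1 : ∀ j : Fin N, (∫ t, ‖((t + 2 * Real.pi * (j : ℕ) / R : ℝ) : ℂ) * FC R (gv f) (j : ℕ) t‖ ^ 2) =
      ∫ y, ‖FC R (gV1 f) (j : ℕ) y‖ ^ 2 := by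
    intro j
    apply integral_congr_ae
    filter_upwards [FC_V1 hR hq hf hp hQ i1 (j : ℕ)] with y hy
    rw [hy]; simp
  simp_rw [e1] at key
  have P0' : ∫ x in KR R, ‖f x‖ ^ 2 = R * ∑ j : Fin N, ∫ y, ‖FC R (gv f) (j : ℕ) y‖ ^ 2 := by
    rw [← P0]; simp_rw [gv_norm]
  rw [hQR, P0']
  constructor
  · exact mul_le_mul_of_nonneg_left (Finset.sum_le_sum fun j _ => (key j).1) hR.le
  · intro ho
    rw [mul_left_comm, Finset.mul_sum]
    exact mul_le_mul_of_nonneg_left (Finset.sum_le_sum fun j _ => (key j).2 (ho j)) hR.le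


lemma annihilated_iff (u : ℝ × ℝ → ℂ) : annihilated u ↔ ∀ z, mg1 u z + Complex.I * mg2 u z = 0 := by
  unfold annihilated
  refine forall_congr' fun z => ?_
  have : mg1 u z + Complex.I * mg2 u z = fderiv ℝ u z (1, 0) + Complex.I * fderiv ℝ u z (0, 1) +
    (1 / 2 : ℂ) * ((z.1 : ℂ) + Complex.I * (z.2 : ℂ)) * u z := by
    simp only [mg1, mg2, A0]
    push_cast
    linear_combination (-(z.1 : ℂ) / 2 * u z) * Complex.I_sq
  rw [this]

lemma annihilated_iff' (u : ℝ × ℝ → ℂ) : annihilated u ↔ ∀ z, gV1 u z + Complex.I * gV2 u z = 0 := by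
  rw [annihilated_iff]
  refine forall_congr' fun z => ?_
  have ne : gf z ≠ 0 := Complex.exp_ne_zero _
  have : gV1 u z + Complex.I * gV2 u z = gf z * (mg1 u z + Complex.I * mg2 u z) := by
    simp only [gV1, gV2]; ring
  rw [this]; simp [ne]

lemma entire_of_ann {u : ℝ × ℝ → ℂ} (hu : Differentiable ℝ u) (ha : annihilated u) :
    Differentiable ℂ (fun z : ℂ => Complex.exp ((z.im : ℂ) ^ 2 / 2) * gv u (z.re, z.im)) := by
  intro z
  have hv := gv_diff hu
  rw [differentiableAt_complex_iff_differentiableAt_real]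
  have h1 : HasFDerivAt (fun z : ℂ => gv u (z.re, z.im)) _ z :=
    HasFDerivAt.comp z (hv (Complex.equivRealProdCLM z)).hasFDerivAt Complex.equivRealProdCLM.hasFDerivAt
  have h0 : HasFDerivAt (fun z : ℂ => (z.im : ℂ)) (Complex.ofRealCLM.comp Complex.imCLM) z :=
    (Complex.ofRealCLM.comp Complex.imCLM).hasFDerivAt
  have h2 : HasFDerivAt (fun z : ℂ => Complex.exp ((z.im : ℂ) ^ 2 / 2))
      ((Complex.exp ((z.im : ℂ) ^ 2 / 2) * z.im) • (Complex.ofRealCLM.comp Complex.imCLM)) z := by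
    have e : (fun z : ℂ => Complex.exp ((z.im : ℂ) ^ 2 / 2)) = fun z : ℂ => Complex.exp ((1 / 2 : ℂ) * ((z.im : ℂ) * z.im)) := by
      funext z; congr 1; ring
    have := ((h0.mul h0).const_mul (1 / 2 : ℂ)).cexp
    rw [e]
    refine this.congr_fderiv ?_
    ext
    simp; ring_nf
  have h3 : HasFDerivAt (fun z : ℂ => Complex.exp ((z.im : ℂ) ^ 2 / 2) * gv u (z.re, z.im)) _ z := h2.mul h1
  refine ⟨h3.differentiableAt, ?_⟩
  rw [h3.fderiv]
  have a := (annihilated_iff' u).1 ha (z.re, z.im)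
  have g1 := (gv_fderiv hu (z.re, z.im)).1
  have g2 := (gv_fderiv hu (z.re, z.im)).2
  have e1 : Complex.equivRealProdCLM z = (z.re, z.im) := rfl
  have e2 : Complex.equivRealProdCLM 1 = (1, 0) := by ext <;> simp
  have e3 : Complex.equivRealProdCLM Complex.I = (0, 1) := by ext <;> simp
  simp [e1, -Complex.equivRealProdCLM_apply, e2, e3, g1, g2]
  linear_combination Complex.exp ((z.im : ℂ) ^ 2 / 2) * (gV2 u (z.re, z.im) + z.im * gv u (z.re, z.im)) * Complex.I_sq  - Complex.I * Complex.exp ((z.im : ℂ) ^ 2 / 2) * a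

/-- Ground state built from an entire function. -/
noncomputable def ofEnt (h : ℂ → ℂ) (z : ℝ × ℝ) : ℂ :=
  (gf z)⁻¹ * (Complex.exp (-((z.2 : ℂ) ^ 2 / 2)) * h (z.1 + Complex.I * z.2))

lemma gv_ofEnt (h : ℂ → ℂ) (z : ℝ × ℝ) :
    gv (ofEnt h) z = Complex.exp (-((z.2 : ℂ) ^ 2 / 2)) * h (z.1 + Complex.I * z.2) := by
  have ne : gf z ≠ 0 := Complex.exp_ne_zero _
  rw [gv, ofEnt, mul_inv_cancel_left₀ ne]

lemma v_contDiff {h : ℂ → ℂ} (hh : Differentiable ℂ h) :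
    ContDiff ℝ 2 (fun z : ℝ × ℝ => Complex.exp (-((z.2 : ℂ) ^ 2 / 2)) * h (z.1 + Complex.I * z.2)) := by
  have h1 : ContDiff ℝ 2 (fun z : ℝ × ℝ => (z.1 : ℂ)) := Complex.ofRealCLM.contDiff.comp contDiff_fst
  have h2 : ContDiff ℝ 2 (fun z : ℝ × ℝ => (z.2 : ℂ)) := Complex.ofRealCLM.contDiff.comp contDiff_snd
  have h3 : ContDiff ℝ 2 h := (hh.contDiff (n := 2)).restrict_scalars ℝ
  refine ContDiff.mul ?_ (h3.comp (h1.add (contDiff_const.mul h2)))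
  exact ((h2.pow 2).div_const 2).neg.cexp

lemma ann_of_entire {h : ℂ → ℂ} (hh : Differentiable ℂ h) :
    Differentiable ℝ (ofEnt h) ∧ annihilated (ofEnt h) := by
  have hv := (v_contDiff hh).differentiable (by norm_num)
  have hu : Differentiable ℝ (ofEnt h) := by
    intro z
    exact ((gf_hasFDerivAt z).differentiableAt.inv (Complex.exp_ne_zero _)).mul (hv z)
  refine ⟨hu, ?_⟩
  rw [annihilated_iff']
  intro z
  have g1 := (gv_fderiv hu z).1
  have g2 := (gv_fderiv hu z).2
  have e : gv (ofEnt h) = fun z : ℝ × ℝ => Complex.exp (-((z.2 : ℂ) ^ 2 / 2)) * h (z.1 + Complex.I * z.2) := by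
    funext z; exact gv_ofEnt h z
  have h1 : HasFDerivAt (fun z : ℝ × ℝ => (z.1 : ℂ)) (Complex.ofRealCLM.comp (ContinuousLinearMap.fst ℝ ℝ ℝ)) z :=
    (Complex.ofRealCLM.comp (ContinuousLinearMap.fst ℝ ℝ ℝ)).hasFDerivAt
  have h2 : HasFDerivAt (fun z : ℝ × ℝ => (z.2 : ℂ)) (Complex.ofRealCLM.comp (ContinuousLinearMap.snd ℝ ℝ ℝ)) z :=
    (Complex.ofRealCLM.comp (ContinuousLinearMap.snd ℝ ℝ ℝ)).hasFDerivAt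
  have h3 : HasFDerivAt (fun z : ℝ × ℝ => Complex.exp (-((z.2 : ℂ) ^ 2 / 2)))
      ((-Complex.exp (-((z.2 : ℂ) ^ 2 / 2)) * z.2) • (Complex.ofRealCLM.comp (ContinuousLinearMap.snd ℝ ℝ ℝ))) z := by
    have e : (fun z : ℝ × ℝ => Complex.exp (-((z.2 : ℂ) ^ 2 / 2))) = fun z : ℝ × ℝ => Complex.exp ((-1 / 2 : ℂ) * ((z.2 : ℂ) * z.2)) := by
      funext z; congr 1; ring
    rw [e]
    refine ((h2.mul h2).const_mul (-1 / 2 : ℂ)).cexp.congr_fderiv ?_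
    ext
    · simp
    · simp
      ring_nf
  have h3' : HasFDerivAt (𝕜 := ℝ) h _ (z.1 + Complex.I * z.2) :=
    (hh (z.1 + Complex.I * z.2)).hasDerivAt.hasFDerivAt.restrictScalars ℝ
  have h4 : HasFDerivAt (𝕜 := ℝ) (fun z : ℝ × ℝ => h (z.1 + Complex.I * z.2)) _ z :=
    HasFDerivAt.comp z h3' (h1.add (h2.const_mul Complex.I))
  have h5 := h3.mul h4
  change HasFDerivAt (fun z : ℝ × ℝ => Complex.exp (-((z.2 : ℂ) ^ 2 / 2)) * h (z.1 + Complex.I * z.2)) _ z at h5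
  rw [← e] at h5
  rw [h5.fderiv] at g1 g2
  rw [gv_ofEnt] at g1
  simp at g1 g2
  rw [← g2]
  linear_combination (-g1 + Complex.exp (-((z.2 : ℂ) ^ 2 / 2)) * deriv h (z.1 + Complex.I * z.2) * Complex.I_sq)

/-- Every ground state has the form `ofEnt h`. -/
lemma ground_form {u : ℝ × ℝ → ℂ} (hu : Differentiable ℝ u) (ha : annihilated u) :
    ∃ h : ℂ → ℂ, Differentiable ℂ h ∧ u = ofEnt h := by
  refine ⟨_, entire_of_ann hu ha, ?_⟩
  funext z
  have ne : gf z ≠ 0 := Complex.exp_ne_zero _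
  have : Complex.exp (-((z.2 : ℂ) ^ 2 / 2)) * Complex.exp ((z.2 : ℂ) ^ 2 / 2) = 1 := by
    rw [← Complex.exp_add]; simp
  simp only [ofEnt, Complex.add_re, Complex.add_im, Complex.ofReal_re, Complex.ofReal_im, Complex.mul_re, Complex.mul_im, Complex.I_re, Complex.I_im]
  simp only [zero_mul, one_mul, mul_zero, sub_zero, add_zero, zero_add]
  rw [← mul_assoc (Complex.exp _), this, one_mul, gv, inv_mul_cancel_left₀ ne]

lemma ground_of_entire {R : ℝ} {N : ℕ} (hR : 0 < R) (hq : R ^ 2 = 2 * Real.pi * N) {h : ℂ → ℂ} (hh : Differentiable ℂ h)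
    (h1 : ∀ z, h (z + R) = h z)
    (h2 : ∀ z, h (z + Complex.I * R) = Complex.exp (R ^ 2 / 2 - Complex.I * R * z) * h z) :
    groundState R N (ofEnt h) := by
  obtain ⟨a, b⟩ := ann_of_entire hh
  refine ⟨a, (inER_iff hR hq).2 ⟨fun x y => ?_, fun x y => ?_⟩, b⟩
  · rw [gv_ofEnt, gv_ofEnt]; congr 1
    rw [← h1 (x + _)]; push_cast; ring_nf
  · rw [gv_ofEnt, gv_ofEnt]
    have := h2 (x + Complex.I * y)
    rw [show (x : ℂ) + Complex.I * y + Complex.I * R = x + Complex.I * ((y + R : ℝ) : ℂ) by push_cast; ring] at this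
    simp only
    rw [this, ← mul_assoc, ← mul_assoc, ← Complex.exp_add, ← Complex.exp_add]
    congr 2
    push_cast
    linear_combination (-R * y : ℂ) * Complex.I_sq


lemma gv_contDiff_of_ground {R : ℝ} {N : ℕ} {u : ℝ × ℝ → ℂ} (hu : groundState R N u) : ContDiff ℝ 2 (gv u) := by
  obtain ⟨h, hh, rfl⟩ := ground_form hu.1 hu.2.2
  have := v_contDiff hh
  rwa [← (funext (gv_ofEnt h) : gv (ofEnt h) = _)] at this

lemma gV_cont {R : ℝ} {N : ℕ} {u : ℝ × ℝ → ℂ} (hu : groundState R N u) :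
    Continuous (gV1 u) ∧ Continuous (gV2 u) := by
  have hv := gv_contDiff_of_ground hu
  have hc := hv.continuous_fderiv (by norm_num)
  have e1 : gV1 u = fun z => fderiv ℝ (gv u) z (1, 0) + Complex.I * z.2 * gv u z := by
    funext z; rw [(gv_fderiv hu.1 z).1]; ring
  have e2 : gV2 u = fun z => fderiv ℝ (gv u) z (0, 1) := by
    funext z; rw [(gv_fderiv hu.1 z).2]
  have := hv.continuous
  rw [e1, e2]
  constructor <;> fun_prop

lemma cont_int_KR {E : Type*} [NormedAddCommGroup E] {R : ℝ} {h : ℝ × ℝ → E} (hc : Continuous h) :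
    IntegrableOn h (KR R) := by
  have : IntegrableOn h (Set.Icc 0 R ×ˢ Set.Icc 0 R) :=
    hc.continuousOn.integrableOn_compact (isCompact_Icc.prod isCompact_Icc)
  exact this.mono_set (Set.prod_mono Set.Ioo_subset_Icc_self Set.Ioo_subset_Icc_self)

lemma FC_add_smul {R : ℝ} {h1 h2 : ℝ × ℝ → ℂ} (hc1 : Continuous h1) (hc2 : Continuous h2) (c : ℂ) (k : ℤ) (y : ℝ) :
    FC R (fun z => h1 z + c * h2 z) k y = FC R h1 k y + c * FC R h2 k y := by
  unfold FC
  rw [mul_left_comm, ← mul_add]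
  congr 1
  rw [← intervalIntegral.integral_const_mul, ← intervalIntegral.integral_add]
  · congr 1; funext x; ring
  · apply Continuous.intervalIntegrable; fun_prop
  · apply Continuous.intervalIntegrable; fun_prop

lemma ground_FC {R : ℝ} {N : ℕ} (hN : 0 < N) (hR : 0 < R) (hq : R ^ 2 = 2 * Real.pi * N)
    {u : ℝ × ℝ → ℂ} (hu : groundState R N u) (j : Fin N) (y : ℝ) :
    FC R (gv u) (j : ℕ) y = FC R (gv u) (j : ℕ) 0 *
      Complex.exp (-((y : ℂ) ^ 2 / 2 + 2 * Real.pi * (j : ℕ) / R * y)) := by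
  obtain ⟨hf, hE, ha⟩ := id hu
  obtain ⟨hp, hQ⟩ := (inER_iff hR hq).1 hE
  obtain ⟨c1, c2⟩ := gV_cont hu
  have i2 : IntegrableOn (fun z => ‖gV2 u z‖ ^ 2) (KR R) := cont_int_KR (c2.norm.pow 2)
  obtain ⟨L2, -⟩ := parseval_real hN hR hq (V_QP hf hQ).2 (gV2_meas hf) i2
  have pr := FC_prim hR hq hf hQ i2 _ (L2 j)
  have hV2 : gV2 u = fun z => (fun _ => (0:ℂ)) z + Complex.I * gV1 u z := by
    funext z
    have := (annihilated_iff' u).1 ha z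
    simp only
    linear_combination (-Complex.I) * this + gV2 u z * Complex.I_sq
  set α : ℝ := 2 * Real.pi * (j : ℕ) / R with hα
  have F2 : ∀ t, FC R (gV2 u) (j : ℕ) t = -((t + α : ℝ) : ℂ) * FC R (gv u) (j : ℕ) t := by
    intro t
    rw [hV2, FC_add_smul continuous_const c1, FC_V1_slice hR hf hp t]
    · have : FC R (fun _ => (0:ℂ)) (j : ℕ) t = 0 := by simp [FC]
      rw [this, hα]; push_cast
      linear_combination (((t:ℂ) + 2 * Real.pi * (j:ℕ) / R) * FC R (gv u) (j:ℕ) t) * Complex.I_sq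
    · have : Continuous (fun x => gV1 u (x, t)) := c1.comp (by fun_prop)
      exact (this.continuousOn.integrableOn_compact isCompact_Icc).mono_set Set.Ioc_subset_Icc_self
  set g := FC R (gv u) (j : ℕ) with hg
  have hdl : LocallyIntegrable (FC R (gV2 u) (j : ℕ)) := (L2 j).locallyIntegrable (by norm_num)
  have hii : ∀ a b, IntervalIntegrable (FC R (gV2 u) (j : ℕ)) volume a b := fun a b =>
    (hdl.integrableOn_isCompact isCompact_uIcc).intervalIntegrable
  have e : g = fun y => g 0 + ∫ t in (0:ℝ)..y, FC R (gV2 u) (j : ℕ) t := by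
    funext y; rw [← pr 0 y]; ring
  have gc : Continuous g := by
    rw [e]
    exact continuous_const.add (intervalIntegral.continuous_primitive hii 0)
  have dc : Continuous (FC R (gV2 u) (j : ℕ)) := by
    rw [funext F2]; fun_prop
  have hd : ∀ t, HasDerivAt g (-((t + α : ℝ) : ℂ) * g t) t := by
    intro t
    rw [← F2]
    conv => enter [1]; rw [e]
    exact (intervalIntegral.integral_hasDerivAt_right (hii _ _) (dc.stronglyMeasurableAtFilter _ _) dc.continuousAt).const_add _
  have hd2 : ∀ t : ℝ, HasDerivAt (fun t : ℝ => Complex.exp ((t : ℂ) ^ 2 / 2 + α * t) * g t) 0 t := by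
    intro t
    have h0 : HasDerivAt (fun x : ℝ => (x : ℂ)) 1 t := Complex.ofRealCLM.hasDerivAt
    have h1 := (((h0.mul h0).div_const 2).add (h0.const_mul (α : ℂ))).cexp
    have h2 : HasDerivAt (fun t : ℝ => Complex.exp ((t : ℂ) ^ 2 / 2 + α * t)) (Complex.exp ((t : ℂ) ^ 2 / 2 + α * t) * (t + α)) t := by
      have e : (fun t : ℝ => Complex.exp ((t : ℂ) ^ 2 / 2 + α * t)) = fun t : ℝ => Complex.exp ((t : ℂ) * t / 2 + α * t) := by
        funext t; rw [sq]
      rw [e]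
      refine h1.congr_deriv ?_
      simp only [Pi.mul_apply, Pi.add_apply]
      rw [sq]; ring
    refine (h2.mul (hd t)).congr_deriv ?_
    push_cast; ring
  have const := is_const_of_deriv_eq_zero (fun t => (hd2 t).differentiableAt) (fun t => (hd2 t).deriv) y 0
  rw [show ((0:ℝ):ℂ) ^ 2 / 2 + α * ((0:ℝ):ℂ) = 0 by simp, Complex.exp_zero, one_mul] at const
  rw [← const, mul_comm, ← mul_assoc, ← Complex.exp_add, hα]
  push_cast
  simp

lemma zero_of_int {R : ℝ} (hR : 0 < R) {w : ℝ × ℝ → ℂ} (hc : Continuous w)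
    (h1 : ∀ x y, ‖w (x + R, y)‖ = ‖w (x, y)‖) (h2 : ∀ x y, ‖w (x, y + R)‖ = ‖w (x, y)‖)
    (hi : ∫ z in KR R, ‖w z‖ ^ 2 = 0) : ∀ z, w z = 0 := by
  have ho : IsOpen (KR R) := isOpen_Ioo.prod isOpen_Ioo
  have c2 : Continuous (fun z => ‖w z‖ ^ 2) := hc.norm.pow 2
  rw [integral_eq_zero_iff_of_nonneg (fun z => by positivity) (cont_int_KR c2)] at hi
  have k1 : Set.EqOn (fun z => ‖w z‖ ^ 2) 0 (KR R) :=
    Measure.eqOn_open_of_ae_eq hi ho c2.continuousOn continuousOn_const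
  have k2 : closure (KR R) ⊆ {z | ‖w z‖ ^ 2 = 0} :=
    closure_minimal (fun z hz => k1 hz) (isClosed_eq c2 continuous_const)
  rw [KR, closure_prod_eq, closure_Ioo hR.ne] at k2
  rintro ⟨x, y⟩
  have p1 : Function.Periodic (fun x => ‖w (x, y)‖) R := fun x => h1 x y
  obtain ⟨x', hx', ex⟩ := p1.exists_mem_Ico₀ hR x
  have p2 : Function.Periodic (fun y => ‖w (x', y)‖) R := fun y => h2 x' y
  obtain ⟨y', hy', ey⟩ := p2.exists_mem_Ico₀ hR y
  have := k2 (show (x', y') ∈ _ from ⟨Set.Ico_subset_Icc_self hx', Set.Ico_subset_Icc_self hy'⟩)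
  simp only [Set.mem_ofPred_eq] at this
  rw [← ey, ← ex] at this
  simpa using this

lemma ground_zero {R : ℝ} {N : ℕ} (hN : 0 < N) (hR : 0 < R) (hq : R ^ 2 = 2 * Real.pi * N)
    {u : ℝ × ℝ → ℂ} (hu : groundState R N u) (hz : ∀ j : Fin N, FC R (gv u) (j : ℕ) 0 = 0) : u = 0 := by
  obtain ⟨hf, hE, ha⟩ := id hu
  obtain ⟨hp, hQ⟩ := (inER_iff hR hq).1 hE
  have hc := (gv_diff hf).continuous
  have i0 : IntegrableOn (fun z => ‖gv u z‖ ^ 2) (KR R) := cont_int_KR (hc.norm.pow 2)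
  obtain ⟨-, P⟩ := parseval_real hN hR hq hQ (gv_meas hf) i0
  have : ∀ j : Fin N, ∫ y, ‖FC R (gv u) (j : ℕ) y‖ ^ 2 = 0 := by
    intro j
    have : ∀ y, FC R (gv u) (j : ℕ) y = 0 := fun y => by
      rw [ground_FC hN hR hq hu j, hz, zero_mul]
    simp [this]
  simp_rw [this] at P
  simp only [Finset.sum_const_zero, mul_zero] at P
  have v0 : ∀ z, gv u z = 0 := zero_of_int hR hc (fun x y => by rw [hp]) (fun x y => by
    rw [hQ, norm_mul, show -(Complex.I * R * x) = ((-(R * x) : ℝ) : ℂ) * Complex.I by push_cast; ring,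
      Complex.norm_exp_ofReal_mul_I, one_mul]) P
  funext z
  have := v0 z
  rw [← norm_eq_zero, gv_norm, norm_eq_zero] at this
  exact this



/-- The theta functions. -/
noncomputable def thE (R : ℝ) (N : ℕ) (j : ℕ) (z : ℂ) : ℂ :=
  Complex.exp (2 * Real.pi * Complex.I * j * z / R) *
    jacobiTheta₂ (N * z / R + Complex.I * j) (Complex.I * N)

lemma theta_period (n : ℕ) (z τ : ℂ) : jacobiTheta₂ (z + n) τ = jacobiTheta₂ z τ := by
  have p : Function.Periodic (fun z => jacobiTheta₂ z τ) 1 := fun z => jacobiTheta₂_add_left z τ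
  simpa using p.nat_mul n z

lemma thE_diff {R : ℝ} {N : ℕ} (hN : 0 < N) (j : ℕ) : Differentiable ℂ (thE R N j) := by
  intro z
  have hτ : 0 < (Complex.I * N).im := by simpa using hN
  have h1 : DifferentiableAt ℂ (fun z => jacobiTheta₂ (N * z / R + Complex.I * j) (Complex.I * N)) z := by
    have := differentiableAt_jacobiTheta₂_fst (N * z / R + Complex.I * j) hτ
    exact DifferentiableAt.fun_comp' (g := fun w => jacobiTheta₂ w (Complex.I * N)) z this (by fun_prop)
  unfold thE
  exact DifferentiableAt.mul (by fun_prop) h1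

lemma thE_per {R : ℝ} {N : ℕ} (hR : 0 < R) (j : ℕ) (z : ℂ) : thE R N j (z + R) = thE R N j z := by
  have hR' : (R : ℂ) ≠ 0 := by exact_mod_cast hR.ne'
  unfold thE
  rw [show (N : ℂ) * (z + R) / R + Complex.I * j = (N * z / R + Complex.I * j) + N by field_simp; ring, theta_period]
  rw [show 2 * Real.pi * Complex.I * j * (z + R) / R = 2 * Real.pi * Complex.I * j * z / R + j * (2 * Real.pi * Complex.I) by
    field_simp, Complex.exp_add, Complex.exp_nat_mul_two_pi_mul_I, mul_one]

lemma thE_shift {R : ℝ} {N : ℕ} (hN : 0 < N) (hR : 0 < R) (j : ℕ) (z : ℂ) : thE R N j (z + R / N) =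
    Complex.exp (2 * Real.pi * Complex.I * j / N) * thE R N j z := by
  have hR' : (R : ℂ) ≠ 0 := by exact_mod_cast hR.ne'
  have hN' : (N : ℂ) ≠ 0 := by exact_mod_cast hN.ne'
  unfold thE
  rw [show (N : ℂ) * (z + R / N) / R + Complex.I * j = (N * z / R + Complex.I * j) + 1 by field_simp; ring, jacobiTheta₂_add_left]
  rw [show 2 * Real.pi * Complex.I * j * (z + R / N) / R = 2 * Real.pi * Complex.I * j / N + 2 * Real.pi * Complex.I * j * z / R by
    field_simp; ring, Complex.exp_add, mul_assoc]

lemma thE_quasi {R : ℝ} {N : ℕ} (hR : 0 < R) (hq : R ^ 2 = 2 * Real.pi * N) (j : ℕ) (z : ℂ) :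
    thE R N j (z + Complex.I * R) = Complex.exp (R ^ 2 / 2 - Complex.I * R * z) * thE R N j z := by
  have hR' : (R : ℂ) ≠ 0 := by exact_mod_cast hR.ne'
  have hq' : (R : ℂ) ^ 2 = 2 * Real.pi * N := by exact_mod_cast hq
  have hq2 : (R : ℂ) = 2 * Real.pi * N / R := by field_simp; exact hq'
  unfold thE
  rw [show (N : ℂ) * (z + Complex.I * R) / R + Complex.I * j = (N * z / R + Complex.I * j) + Complex.I * N by
    field_simp; ring, jacobiTheta₂_add_left', ← mul_assoc, ← mul_assoc, ← Complex.exp_add, ← Complex.exp_add]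
  congr 2
  rw [hq', show Complex.I * R * z = Complex.I * (2 * Real.pi * N / R) * z by rw [← hq2]]
  field_simp
  linear_combination (-R * N : ℂ) * Complex.I_sq

lemma thE_ne {R : ℝ} {N : ℕ} (hN : 0 < N) (hR : 0 < R) (j : ℕ) : ∃ z, thE R N j z ≠ 0 := by
  have hR' : (R : ℂ) ≠ 0 := by exact_mod_cast hR.ne'
  have hN' : (N : ℂ) ≠ 0 := by exact_mod_cast hN.ne'
  refine ⟨-(Complex.I * j * R / N), ?_⟩
  unfold thE
  refine mul_ne_zero (Complex.exp_ne_zero _) ?_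
  rw [show (N : ℂ) * -(Complex.I * j * R / N) / R + Complex.I * j = 0 by field_simp; ring]
  have hτ : 0 < (Complex.I * N).im := by simpa using hN
  have hs := Complex.hasSum_re (hasSum_jacobiTheta₂_term 0 hτ)
  have e : ∀ n : ℤ, (jacobiTheta₂_term n 0 (Complex.I * N)).re = Real.exp (-(Real.pi * n ^ 2 * N)) := by
    intro n
    unfold jacobiTheta₂_term
    rw [show 2 * Real.pi * Complex.I * n * 0 + Real.pi * Complex.I * n ^ 2 * (Complex.I * N) = ((-(Real.pi * n ^ 2 * N) : ℝ) : ℂ) by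
      push_cast
      linear_combination (Real.pi * n ^ 2 * N : ℂ) * Complex.I_sq, Complex.exp_ofReal_re]
  simp_rw [e] at hs
  have pos : 0 < (jacobiTheta₂ 0 (Complex.I * N)).re := by
    rw [← hs.tsum_eq]
    exact hs.summable.tsum_pos (fun n => (Real.exp_pos _).le) 0 (Real.exp_pos _)
  intro h0
  rw [h0] at pos
  simp at pos

/-- The basis of ground states. -/
noncomputable def thU (R : ℝ) (N : ℕ) (j : Fin N) : ℝ × ℝ → ℂ := ofEnt (thE R N (j : ℕ))

lemma thU_ground {R : ℝ} {N : ℕ} (hN : 0 < N) (hR : 0 < R) (hq : R ^ 2 = 2 * Real.pi * N) (j : Fin N) :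
    groundState R N (thU R N j) :=
  ground_of_entire hR hq (thE_diff hN _) (thE_per hR _) (thE_quasi hR hq _)

lemma thU_ne {R : ℝ} {N : ℕ} (hN : 0 < N) (hR : 0 < R) (j : Fin N) : thU R N j ≠ 0 := by
  obtain ⟨z, hz⟩ := thE_ne hN hR (j : ℕ) (R := R)
  intro h
  have := congrFun h (z.re, z.im)
  rw [thU, ofEnt] at this
  simp only [Pi.zero_apply, mul_eq_zero, inv_eq_zero] at this
  rw [mul_comm Complex.I, Complex.re_add_im] at this
  rcases this with h1 | h1 | h1
  · exact Complex.exp_ne_zero _ h1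
  · exact Complex.exp_ne_zero _ h1
  · exact hz h1

lemma FC_thU_ne {R : ℝ} {N : ℕ} (hN : 0 < N) (hR : 0 < R) (hq : R ^ 2 = 2 * Real.pi * N) {j k : Fin N} (hjk : k ≠ j) (y : ℝ) :
    FC R (gv (thU R N j)) (k : ℕ) y = 0 := by
  have hR' : (R : ℂ) ≠ 0 := by exact_mod_cast hR.ne'
  have hN' : (N : ℂ) ≠ 0 := by exact_mod_cast hN.ne'
  have hg := thU_ground hN hR hq j
  obtain ⟨hp, -⟩ := (inER_iff hR hq).1 hg.2.1
  set F : ℝ → ℂ := fun x => Complex.exp (-(2 * Real.pi * Complex.I * (k : ℕ) * x / R)) * gv (thU R N j) (x, y) with hF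
  have per : Function.Periodic F R := by
    intro x
    simp only [hF]
    rw [hp]
    congr 1
    rw [show -(2 * Real.pi * Complex.I * (k : ℕ) * ((x + R : ℝ) : ℂ) / R) =
      -(2 * Real.pi * Complex.I * (k : ℕ) * x / R) + ((-(k : ℕ) : ℤ) : ℂ) * (2 * Real.pi * Complex.I) by
      push_cast; field_simp; ring, Complex.exp_add, Complex.exp_int_mul_two_pi_mul_I, mul_one]
  set ω : ℂ := Complex.exp (2 * Real.pi * Complex.I * (((j : ℕ) : ℂ) - (k : ℕ)) / N) with hω
  have sh : ∀ x, F (x + R / N) = ω * F x := by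
    intro x
    simp only [hF, thU, gv_ofEnt]
    rw [show (((x + R / N : ℝ) : ℂ) + Complex.I * y) = ((x : ℂ) + Complex.I * y) + R / N by push_cast; ring, thE_shift hN hR]
    rw [show -(2 * Real.pi * Complex.I * (k : ℕ) * ((x + R / N : ℝ) : ℂ) / R) =
      -(2 * Real.pi * Complex.I * (k : ℕ) * x / R) + -(2 * Real.pi * Complex.I * (k : ℕ) / N) by
      push_cast; field_simp; ring, Complex.exp_add, hω,
      show 2 * Real.pi * Complex.I * (((j : ℕ) : ℂ) - (k : ℕ)) / N = -(2 * Real.pi * Complex.I * (k : ℕ) / N) + 2 * Real.pi * Complex.I * (j : ℕ) / N by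
      ring, Complex.exp_add]
    ring
  have e1 : ∫ x in (0:ℝ)..R, F x = ω * ∫ x in (0:ℝ)..R, F x := by
    have h1 := per.intervalIntegral_add_eq 0 (R / N)
    rw [zero_add] at h1
    conv_lhs => rw [h1]
    rw [← intervalIntegral.integral_const_mul]
    simp_rw [← sh]
    rw [intervalIntegral.integral_comp_add_right F, zero_add, add_comm R]
  have ω1 : ω ≠ 1 := by
    intro h
    rw [hω, Complex.exp_eq_one_iff] at h
    obtain ⟨n, hn⟩ := h
    have h2 : (((j : ℕ) : ℂ) - (k : ℕ)) = n * N := by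
      have : (2 * Real.pi * Complex.I : ℂ) ≠ 0 := Complex.two_pi_I_ne_zero
      field_simp at hn
      linear_combination hn
    have h3 : ((j : ℕ) : ℤ) - ((k : ℕ) : ℤ) = n * N := by exact_mod_cast h2
    have hj := j.2
    have hk := k.2
    have h4 : n = 0 := by
      by_contra hn0
      rcases lt_or_gt_of_ne hn0 with h | h
      · nlinarith
      · nlinarith
    rw [h4, zero_mul] at h3
    apply hjk
    apply Fin.ext
    omega
  have z0 : ∫ x in (0:ℝ)..R, F x = 0 := by
    have : (1 - ω) * ∫ x in (0:ℝ)..R, F x = 0 := by linear_combination e1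
    rcases mul_eq_zero.1 this with h | h
    · exact absurd (sub_eq_zero.1 h).symm ω1
    · exact h
  unfold FC
  change _ * (∫ x in (0:ℝ)..R, F x) = 0
  rw [z0, mul_zero]

lemma FC_thU_self {R : ℝ} {N : ℕ} (hN : 0 < N) (hR : 0 < R) (hq : R ^ 2 = 2 * Real.pi * N) (j : Fin N) :
    FC R (gv (thU R N j)) (j : ℕ) 0 ≠ 0 := by
  intro h
  refine thU_ne hN hR j (ground_zero hN hR hq (thU_ground hN hR hq j) fun k => ?_)
  by_cases hk : k = j
  · rw [hk]; exact h
  · exact FC_thU_ne hN hR hq hk 0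


/-- The space of ground states. -/
def GS (R : ℝ) (N : ℕ) : Submodule ℂ (ℝ × ℝ → ℂ) where
  carrier := {u | groundState R N u}
  zero_mem' := by
    refine ⟨differentiable_const 0, ⟨fun z => by simp, fun z => by simp⟩, fun z => ?_⟩
    have : fderiv ℝ (0 : ℝ × ℝ → ℂ) z = 0 := by simp
    rw [this]; simp
  add_mem' := by
    rintro u w ⟨hu1, ⟨hu2, hu3⟩, hu4⟩ ⟨hw1, ⟨hw2, hw3⟩, hw4⟩
    refine ⟨hu1.add hw1, ⟨fun z => ?_, fun z => ?_⟩, fun z => ?_⟩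
    · simp only [Pi.add_apply]; rw [hu2, hw2]; ring
    · simp only [Pi.add_apply]; rw [hu3, hw3]; ring
    · rw [fderiv_add (hu1 z) (hw1 z)]
      simp only [Pi.add_apply, add_apply]
      linear_combination hu4 z + hw4 z
  smul_mem' := by
    rintro c u ⟨hu1, ⟨hu2, hu3⟩, hu4⟩
    refine ⟨hu1.const_smul c, ⟨fun z => ?_, fun z => ?_⟩, fun z => ?_⟩
    · simp only [Pi.smul_apply, smul_eq_mul]; rw [hu2]; ring
    · simp only [Pi.smul_apply, smul_eq_mul]; rw [hu3]; ring
    · rw [fderiv_const_smul (hu1 z)]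
      simp only [Pi.smul_apply, smul_eq_mul, smul_apply]
      linear_combination c * hu4 z

/-- Coordinates of ground states. -/
noncomputable def GSc (R : ℝ) (N : ℕ) : GS R N →ₗ[ℂ] (Fin N → ℂ) where
  toFun u j := FC R (gv u.1) (j : ℕ) 0
  map_add' := by
    intro u w
    funext j
    have h1 := (gv_diff u.2.1).continuous
    have h2 := (gv_diff w.2.1).continuous
    have := FC_add_smul (R := R) h1 h2 1 (j : ℕ) 0
    rw [one_mul] at this
    rw [Pi.add_apply, ← this]
    congr 1
    funext z
    simp only [gv, Submodule.coe_add, Pi.add_apply]; ring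
  map_smul' := by
    intro c u
    funext j
    have h1 := (gv_diff u.2.1).continuous
    have := FC_add_smul (R := R) (h1 := fun _ => 0) continuous_const h1 c (j : ℕ) 0
    have h0 : FC R (fun _ => (0:ℂ)) (j : ℕ) 0 = 0 := by simp [FC]
    rw [h0, zero_add] at this
    simp only [Pi.smul_apply, smul_eq_mul, RingHom.id_apply]
    rw [← this]
    congr 1
    funext z
    simp only [gv, Submodule.coe_smul, Pi.smul_apply, smul_eq_mul]; ring

lemma GSc_inj {R : ℝ} {N : ℕ} (hN : 0 < N) (hR : 0 < R) (hq : R ^ 2 = 2 * Real.pi * N) :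
    ∀ u : GS R N, GSc R N u = 0 → u = 0 := by
  intro u hu
  apply Subtype.ext
  exact ground_zero hN hR hq u.2 (fun j => congrFun hu j)

lemma GSc_sum {R : ℝ} {N : ℕ} (hN : 0 < N) (hR : 0 < R) (hq : R ^ 2 = 2 * Real.pi * N) (c : Fin N → ℂ) (j : Fin N) :
    GSc R N (∑ i, c i • (⟨thU R N i, thU_ground hN hR hq i⟩ : GS R N)) j = c j * FC R (gv (thU R N j)) (j : ℕ) 0 := by
  rw [map_sum, Finset.sum_apply, Finset.sum_eq_single j]
  · rw [map_smul]; rfl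
  · intro i _ hij
    rw [map_smul]
    change c i * FC R (gv (thU R N i)) (j : ℕ) 0 = 0
    rw [FC_thU_ne hN hR hq (Ne.symm hij), mul_zero]
  · simp

lemma dim_part {R : ℝ} {N : ℕ} (hN : 0 < N) (hR : 0 < R) (hq : R ^ 2 = 2 * Real.pi * N) :
    LinearIndependent ℂ (thU R N) ∧
      ∀ u : ℝ × ℝ → ℂ, groundState R N u → ∃ c : Fin N → ℂ, u = ∑ i, c i • thU R N i := by
  have hcoe : ∀ c : Fin N → ℂ, ((∑ i, c i • (⟨thU R N i, thU_ground hN hR hq i⟩ : GS R N) : GS R N) : ℝ × ℝ → ℂ) = ∑ i, c i • thU R N i := by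
    intro c
    rw [AddSubmonoidClass.coe_finsetSum]
    rfl
  constructor
  · rw [Fintype.linearIndependent_iff]
    intro c hc j
    have h0 : (∑ i, c i • (⟨thU R N i, thU_ground hN hR hq i⟩ : GS R N)) = 0 := by
      apply Subtype.ext; rw [hcoe, hc]; rfl
    have := GSc_sum hN hR hq c j
    rw [h0, map_zero] at this
    rcases mul_eq_zero.1 this.symm with h | h
    · exact h
    · exact absurd h (FC_thU_self hN hR hq j)
  · intro u hu
    refine ⟨fun j => FC R (gv u) (j : ℕ) 0 / FC R (gv (thU R N j)) (j : ℕ) 0, ?_⟩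
    set c : Fin N → ℂ := fun j => FC R (gv u) (j : ℕ) 0 / FC R (gv (thU R N j)) (j : ℕ) 0 with hc
    have := GSc_inj hN hR hq ((⟨u, hu⟩ : GS R N) - ∑ i, c i • (⟨thU R N i, thU_ground hN hR hq i⟩ : GS R N)) (by
      funext j
      rw [map_sub, Pi.sub_apply, GSc_sum hN hR hq c j, hc]
      simp only
      rw [div_mul_cancel₀ _ (FC_thU_self hN hR hq j)]
      exact sub_self _)
    have := congrArg Subtype.val (sub_eq_zero.1 this)
    rw [hcoe] at this
    exact this

lemma L2_expand {α : Type*} [MeasurableSpace α] {μ : Measure α} {a b : α → ℂ} (ha : MemLp a 2 μ) (hb : MemLp b 2 μ) (c : ℂ) :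
    ∫ t, ‖a t + c * b t‖ ^ 2 ∂μ = ∫ t, ‖a t‖ ^ 2 ∂μ + ‖c‖ ^ 2 * ∫ t, ‖b t‖ ^ 2 ∂μ +
      2 * (c * ∫ t, (starRingEnd ℂ) (a t) * b t ∂μ).re := by
  have i1 : Integrable (fun t => ‖a t‖ ^ 2) μ := ha.integrable_norm_pow (by norm_num)
  have i2 : Integrable (fun t => ‖b t‖ ^ 2) μ := hb.integrable_norm_pow (by norm_num)
  have i3 : Integrable (fun t => (starRingEnd ℂ) (a t) * b t) μ := by
    have : MemLp (fun t => (starRingEnd ℂ) (a t)) 2 μ := ha.star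
    exact MemLp.integrable_mul this hb
  have i4 := i3.const_mul c
  have e : ∀ t, ‖a t + c * b t‖ ^ 2 = ‖a t‖ ^ 2 + ‖c‖ ^ 2 * ‖b t‖ ^ 2 + 2 * (c * ((starRingEnd ℂ) (a t) * b t)).re := by
    intro t
    simp only [← Complex.normSq_eq_norm_sq, Complex.normSq_apply]
    simp
    ring
  simp_rw [e]
  have i5 : Integrable (fun t => (c * ((starRingEnd ℂ) (a t) * b t)).re) μ := i4.re
  have i6 : Integrable (fun t => ‖a t‖ ^ 2 + ‖c‖ ^ 2 * ‖b t‖ ^ 2) μ := i1.add (i2.const_mul _)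
  rw [integral_add i6 (i5.const_mul 2), integral_add i1 (i2.const_mul _), integral_const_mul, integral_const_mul]
  congr 2
  rw [← integral_const_mul]
  exact integral_re i4

lemma parseval_polar {R : ℝ} {N : ℕ} (hN : 0 < N) (hR : 0 < R) (hq : R ^ 2 = 2 * Real.pi * N)
    {a b : ℝ × ℝ → ℂ} (hQa : QP R a) (hQb : QP R b) (ca : Continuous a) (cb : Continuous b) :
    ∫ z in KR R, (starRingEnd ℂ) (a z) * b z = R * ∑ j : Fin N, ∫ y, (starRingEnd ℂ) (FC R a (j : ℕ) y) * FC R b (j : ℕ) y := by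
  have ia : IntegrableOn (fun z => ‖a z‖ ^ 2) (KR R) := cont_int_KR (ca.norm.pow 2)
  have ib : IntegrableOn (fun z => ‖b z‖ ^ 2) (KR R) := cont_int_KR (cb.norm.pow 2)
  have La : MemLp a 2 (volume.restrict (KR R)) := (memLp_two_iff_integrable_sq_norm ca.aestronglyMeasurable).2 ia
  have Lb : MemLp b 2 (volume.restrict (KR R)) := (memLp_two_iff_integrable_sq_norm cb.aestronglyMeasurable).2 ib
  obtain ⟨LA, PA⟩ := parseval_real hN hR hq hQa ca.measurable ia
  obtain ⟨LB, PB⟩ := parseval_real hN hR hq hQb cb.measurable ib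
  have key : ∀ c : ℂ, (c * ∫ z in KR R, (starRingEnd ℂ) (a z) * b z).re =
      (c * (R * ∑ j : Fin N, ∫ y, (starRingEnd ℂ) (FC R a (j : ℕ) y) * FC R b (j : ℕ) y)).re := by
    intro c
    have cc : Continuous (fun z => a z + c * b z) := by fun_prop
    obtain ⟨-, P⟩ := parseval_real hN hR hq (h := fun z => a z + c * b z) (fun x y => by
      simp only; rw [hQa, hQb]; ring) cc.measurable (cont_int_KR (cc.norm.pow 2))
    simp_rw [FC_add_smul ca cb c] at P
    rw [L2_expand La Lb c] at P
    simp_rw [fun j : Fin N => L2_expand (LA j) (LB j) c] at P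
    rw [Finset.sum_add_distrib, Finset.sum_add_distrib, ← Finset.mul_sum, ← Finset.mul_sum, PA, PB] at P
    have e : (c * (R * ∑ j : Fin N, ∫ y, (starRingEnd ℂ) (FC R a (j : ℕ) y) * FC R b (j : ℕ) y)).re =
        R * ∑ j : Fin N, (c * ∫ y, (starRingEnd ℂ) (FC R a (j : ℕ) y) * FC R b (j : ℕ) y).re := by
      rw [mul_left_comm, Complex.re_ofReal_mul, Finset.mul_sum, Complex.re_sum]
    rw [e]
    linarith
  have k1 := key 1
  have k2 := key (-Complex.I)
  rw [one_mul, one_mul] at k1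
  simp only [neg_mul, Complex.neg_re, Complex.I_mul_re, neg_neg] at k2
  exact Complex.ext k1 k2

lemma orth_part {R : ℝ} {N : ℕ} (hN : 0 < N) (hR : 0 < R) (hq : R ^ 2 = 2 * Real.pi * N) {f : ℝ × ℝ → ℂ}
    (hf : Differentiable ℝ f) (hE : inER R N f)
    (ho : ∀ v : ℝ × ℝ → ℂ, groundState R N v → (∫ x in KR R, (starRingEnd ℂ) (v x) * f x) = 0) (j : Fin N) :
    ∫ t, ((Real.exp (-(t + 2 * Real.pi * (j : ℕ) / R) ^ 2 / 2) : ℝ) : ℂ) * FC R (gv f) (j : ℕ) t = 0 := by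
  have hg := thU_ground hN hR hq j
  have h1 := ho _ hg
  have e : ∀ x, (starRingEnd ℂ) (thU R N j x) * f x = (starRingEnd ℂ) (gv (thU R N j) x) * gv f x := by
    intro x
    have : (starRingEnd ℂ) (gf x) * gf x = 1 := by
      rw [Complex.conj_mul', gf_norm]; simp
    simp only [gv, map_mul]
    linear_combination (-(starRingEnd ℂ) (thU R N j x) * f x) * this
  simp_rw [e] at h1
  rw [parseval_polar hN hR hq ((inER_iff hR hq).1 hg.2.1).2 ((inER_iff hR hq).1 hE).2
    (gv_diff hg.1).continuous (gv_diff hf).continuous, Finset.sum_eq_single j] at h1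
  · have hR' : (R : ℂ) ≠ 0 := by exact_mod_cast hR.ne'
    have h2 := (mul_eq_zero.1 h1).resolve_left hR'
    set s := FC R (gv (thU R N j)) (j : ℕ) 0 with hs
    set α : ℝ := 2 * Real.pi * (j : ℕ) / R with hα
    have e2 : ∀ y : ℝ, (starRingEnd ℂ) (FC R (gv (thU R N j)) (j : ℕ) y) * FC R (gv f) (j : ℕ) y =
        ((starRingEnd ℂ) s * ((Real.exp (α ^ 2 / 2) : ℝ) : ℂ)) * (((Real.exp (-(y + α) ^ 2 / 2) : ℝ) : ℂ) * FC R (gv f) (j : ℕ) y) := by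
      intro y
      rw [ground_FC hN hR hq hg j y, ← hs]
      rw [show -((y : ℂ) ^ 2 / 2 + 2 * Real.pi * (j : ℕ) / R * y) = ((α ^ 2 / 2 + -(y + α) ^ 2 / 2 : ℝ) : ℂ) by
        rw [hα]; push_cast; ring]
      rw [← Complex.ofReal_exp, Real.exp_add, map_mul, Complex.conj_ofReal]
      push_cast; ring
    simp_rw [e2] at h2
    rw [integral_const_mul] at h2
    refine (mul_eq_zero.1 h2).resolve_left (mul_ne_zero ?_ ?_)
    · rw [map_ne_zero]; exact FC_thU_self hN hR hq j
    · exact_mod_cast (Real.exp_pos _).ne'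
  · intro k _ hk
    simp_rw [FC_thU_ne hN hR hq hk]
    simp
  · simp


lemma per_int1 {R : ℝ} (hR : 0 < R) {p : ℝ × ℝ → ℂ} (hp : ContDiff ℝ 1 p) (h : ∀ x y, p (x + R, y) = p (x, y)) :
    ∫ z in KR R, fderiv ℝ p z (1, 0) = 0 := by
  have hc : Continuous (fun z => fderiv ℝ p z (1, 0)) :=
    (hp.continuous_fderiv (by norm_num)).clm_apply continuous_const
  have i := cont_int_KR (R := R) hc
  have e : (volume : Measure (ℝ × ℝ)).restrict (KR R) = (volume.restrict (Set.Ioc (0:ℝ) R)).prod (volume.restrict (Set.Ioc (0:ℝ) R)) := by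
    rw [KR, Measure.volume_eq_prod, ← Measure.prod_restrict, Measure.restrict_congr_set Ioo_ae_eq_Ioc]
  rw [IntegrableOn, e] at i
  rw [e, integral_prod_symm _ i]
  have : ∀ y, ∫ x in Set.Ioc 0 R, fderiv ℝ p (x, y) (1, 0) = 0 := by
    intro y
    rw [← intervalIntegral.integral_of_le hR.le, intervalIntegral.integral_eq_sub_of_hasDerivAt (f := fun x => p (x, y))]
    · have := h 0 y; rw [zero_add] at this; rw [this, sub_self]
    · intro x _
      have h0 : HasDerivAt (fun x : ℝ => (x, y)) ((1 : ℝ), (0 : ℝ)) x := (hasDerivAt_id x).prodMk (hasDerivAt_const x y)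
      exact (hp.differentiable (by norm_num) (x, y)).hasFDerivAt.comp_hasDerivAt x h0
    · have : Continuous (fun x => fderiv ℝ p (x, y) (1, 0)) := hc.comp (by fun_prop : Continuous fun x : ℝ => (x, y))
      exact this.intervalIntegrable _ _
  simp [this]

lemma per_int2 {R : ℝ} (hR : 0 < R) {p : ℝ × ℝ → ℂ} (hp : ContDiff ℝ 1 p) (h : ∀ x y, p (x, y + R) = p (x, y)) :
    ∫ z in KR R, fderiv ℝ p z (0, 1) = 0 := by
  have hc : Continuous (fun z => fderiv ℝ p z (0, 1)) :=
    (hp.continuous_fderiv (by norm_num)).clm_apply continuous_const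
  have i := cont_int_KR (R := R) hc
  have e : (volume : Measure (ℝ × ℝ)).restrict (KR R) = (volume.restrict (Set.Ioc (0:ℝ) R)).prod (volume.restrict (Set.Ioc (0:ℝ) R)) := by
    rw [KR, Measure.volume_eq_prod, ← Measure.prod_restrict, Measure.restrict_congr_set Ioo_ae_eq_Ioc]
  rw [IntegrableOn, e] at i
  rw [e, integral_prod _ i]
  have : ∀ x, ∫ y in Set.Ioc 0 R, fderiv ℝ p (x, y) (0, 1) = 0 := by
    intro x
    rw [← intervalIntegral.integral_of_le hR.le, intervalIntegral.integral_eq_sub_of_hasDerivAt (f := fun y => p (x, y))]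
    · have := h x 0; rw [zero_add] at this; rw [this, sub_self]
    · intro y _
      have h0 : HasDerivAt (fun y : ℝ => (x, y)) ((0 : ℝ), (1 : ℝ)) y := (hasDerivAt_const y x).prodMk (hasDerivAt_id y)
      exact (hp.differentiable (by norm_num) (x, y)).hasFDerivAt.comp_hasDerivAt y h0
    · have : Continuous (fun y => fderiv ℝ p (x, y) (0, 1)) := hc.comp (by fun_prop : Continuous fun y : ℝ => (x, y))
      exact this.intervalIntegrable _ _
  simp [this]

/-- The annihilation operator applied to `u`. -/
noncomputable def aw (u : ℝ × ℝ → ℂ) (z : ℝ × ℝ) : ℂ := mg1 u z + Complex.I * mg2 u z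

lemma mg_contDiff {u : ℝ × ℝ → ℂ} (hu : ContDiff ℝ 2 u) : ContDiff ℝ 1 (mg1 u) ∧ ContDiff ℝ 1 (mg2 u) := by
  have h1 : ContDiff ℝ 1 (fun z : ℝ × ℝ => ((-z.2 / 2 : ℝ) : ℂ)) :=
    Complex.ofRealCLM.contDiff.comp (contDiff_snd.neg.div_const 2)
  have h2 : ContDiff ℝ 1 (fun z : ℝ × ℝ => ((z.1 / 2 : ℝ) : ℂ)) :=
    Complex.ofRealCLM.contDiff.comp (contDiff_fst.div_const 2)
  have hd : ContDiff ℝ 1 (fderiv ℝ u) := hu.fderiv_right (by norm_num)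
  have hu1 : ContDiff ℝ 1 u := hu.of_le (by norm_num)
  constructor
  · exact (hd.clm_apply contDiff_const).sub ((contDiff_const.mul h1).mul hu1)
  · exact (hd.clm_apply contDiff_const).sub ((contDiff_const.mul h2).mul hu1)

lemma aw_contDiff {u : ℝ × ℝ → ℂ} (hu : ContDiff ℝ 2 u) : ContDiff ℝ 1 (aw u) :=
  (mg_contDiff hu).1.add (contDiff_const.mul (mg_contDiff hu).2)

lemma comm_id {u : ℝ × ℝ → ℂ} (hu : ContDiff ℝ 2 u) (z : ℝ × ℝ) :
    mg1 (aw u) z - Complex.I * mg2 (aw u) z = magLap u z + u z := by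
  have d1 := (mg_contDiff hu).1.differentiable (by norm_num) z
  have d2 := (mg_contDiff hu).2.differentiable (by norm_num) z
  have eaw : fderiv ℝ (aw u) z = fderiv ℝ (mg1 u) z + Complex.I • fderiv ℝ (mg2 u) z := by
    have : HasFDerivAt (aw u) (fderiv ℝ (mg1 u) z + Complex.I • fderiv ℝ (mg2 u) z) z :=
      d1.hasFDerivAt.add (d2.hasFDerivAt.const_mul Complex.I)
    exact this.fderiv
  have hd : DifferentiableAt ℝ (fderiv ℝ u) z :=
    (hu.fderiv_right (m := 1) (by norm_num)).differentiable (by norm_num) z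
  have hud : DifferentiableAt ℝ u z := hu.differentiable (by norm_num) z
  have sym := (hu.contDiffAt (x := z)).isSymmSndFDerivAt (by simp)
  have s := sym.eq (1, 0) (0, 1)
  have f1 : HasFDerivAt (fun z => fderiv ℝ u z (1, 0)) ((fderiv ℝ (fderiv ℝ u) z).flip (1, 0)) z := by
    refine (hd.hasFDerivAt.clm_apply (hasFDerivAt_const _ _)).congr_fderiv ?_
    ext <;> simp
  have f2 : HasFDerivAt (fun z => fderiv ℝ u z (0, 1)) ((fderiv ℝ (fderiv ℝ u) z).flip (0, 1)) z := by
    refine (hd.hasFDerivAt.clm_apply (hasFDerivAt_const _ _)).congr_fderiv ?_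
    ext <;> simp
  have g1 : HasFDerivAt (fun z : ℝ × ℝ => Complex.I * ((-z.2 / 2 : ℝ) : ℂ)) ((-Complex.I / 2) • Complex.ofRealCLM.comp (ContinuousLinearMap.snd ℝ ℝ ℝ)) z := by
    have h2 : HasFDerivAt (fun z : ℝ × ℝ => (z.2 : ℂ)) (Complex.ofRealCLM.comp (ContinuousLinearMap.snd ℝ ℝ ℝ)) z :=
      (Complex.ofRealCLM.comp (ContinuousLinearMap.snd ℝ ℝ ℝ)).hasFDerivAt
    have h3 := h2.const_mul (-Complex.I / 2)
    refine h3.congr_of_eventuallyEq (Filter.Eventually.of_forall fun z => ?_)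
    push_cast; ring
  have g2 : HasFDerivAt (fun z : ℝ × ℝ => Complex.I * ((z.1 / 2 : ℝ) : ℂ)) ((Complex.I / 2) • Complex.ofRealCLM.comp (ContinuousLinearMap.fst ℝ ℝ ℝ)) z := by
    have h2 : HasFDerivAt (fun z : ℝ × ℝ => (z.1 : ℂ)) (Complex.ofRealCLM.comp (ContinuousLinearMap.fst ℝ ℝ ℝ)) z :=
      (Complex.ofRealCLM.comp (ContinuousLinearMap.fst ℝ ℝ ℝ)).hasFDerivAt
    have h3 := h2.const_mul (Complex.I / 2)
    refine h3.congr_of_eventuallyEq (Filter.Eventually.of_forall fun z => ?_)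
    push_cast; ring
  have m1 : HasFDerivAt (mg1 u) _ z := f1.sub (g1.mul hud.hasFDerivAt)
  have m2 : HasFDerivAt (mg2 u) _ z := f2.sub (g2.mul hud.hasFDerivAt)
  have e12 : fderiv ℝ (mg1 u) z (0, 1) = fderiv ℝ (fderiv ℝ u) z (0, 1) (1, 0) - (Complex.I * ((-z.2 / 2 : ℝ) : ℂ) * fderiv ℝ u z (0, 1) - Complex.I / 2 * u z) := by
    rw [m1.fderiv]; simp; ring
  have e21 : fderiv ℝ (mg2 u) z (1, 0) = fderiv ℝ (fderiv ℝ u) z (1, 0) (0, 1) - (Complex.I * ((z.1 / 2 : ℝ) : ℂ) * fderiv ℝ u z (1, 0) + Complex.I / 2 * u z) := by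
    rw [m2.fderiv]; simp; ring
  have com : mg1 (mg2 u) z - mg2 (mg1 u) z = - Complex.I * u z := by
    have a : mg1 (mg2 u) z = fderiv ℝ (mg2 u) z (1, 0) - Complex.I * ((A0 z).1 : ℂ) * mg2 u z := rfl
    have b : mg2 (mg1 u) z = fderiv ℝ (mg1 u) z (0, 1) - Complex.I * ((A0 z).2 : ℂ) * mg1 u z := rfl
    rw [a, b, e12, e21, s]
    simp only [mg1, mg2, A0]
    ring
  have l1 : mg1 (aw u) z = mg1 (mg1 u) z + Complex.I * mg1 (mg2 u) z := by
    have a : mg1 (aw u) z = fderiv ℝ (aw u) z (1, 0) - Complex.I * ((A0 z).1 : ℂ) * aw u z := rfl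
    have b : mg1 (mg1 u) z = fderiv ℝ (mg1 u) z (1, 0) - Complex.I * ((A0 z).1 : ℂ) * mg1 u z := rfl
    have c : mg1 (mg2 u) z = fderiv ℝ (mg2 u) z (1, 0) - Complex.I * ((A0 z).1 : ℂ) * mg2 u z := rfl
    rw [a, b, c, eaw, aw]
    simp; ring
  have l2 : mg2 (aw u) z = mg2 (mg1 u) z + Complex.I * mg2 (mg2 u) z := by
    have a : mg2 (aw u) z = fderiv ℝ (aw u) z (0, 1) - Complex.I * ((A0 z).2 : ℂ) * aw u z := rfl
    have b : mg2 (mg1 u) z = fderiv ℝ (mg1 u) z (0, 1) - Complex.I * ((A0 z).2 : ℂ) * mg1 u z := rfl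
    have c : mg2 (mg2 u) z = fderiv ℝ (mg2 u) z (0, 1) - Complex.I * ((A0 z).2 : ℂ) * mg2 u z := rfl
    rw [a, b, c, eaw, aw]
    simp; ring
  rw [l1, l2, magLap]
  linear_combination Complex.I * com - (mg2 (mg2 u) z + u z) * Complex.I_sq

lemma conj_hasFDerivAt {v : ℝ × ℝ → ℂ} {L : ℝ × ℝ →L[ℝ] ℂ} {z : ℝ × ℝ} (h : HasFDerivAt v L z) :
    HasFDerivAt (fun z => (starRingEnd ℂ) (v z)) ((Complex.conjCLE : ℂ →L[ℝ] ℂ).comp L) z :=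
  (Complex.conjCLE : ℂ →L[ℝ] ℂ).hasFDerivAt.comp z h

lemma last_part {R : ℝ} {N : ℕ} (hR : 0 < R) (hq : R ^ 2 = 2 * Real.pi * N) {u : ℝ × ℝ → ℂ}
    (hu : ContDiff ℝ 2 u) (hE : inER R N u) :
    (∀ x : ℝ × ℝ, -magLap u x = u x) ↔ annihilated u := by
  rw [annihilated_iff]
  constructor
  swap
  · intro h x
    have h0 : aw u = 0 := funext h
    have := comm_id hu x
    rw [h0] at this
    simp [mg1, mg2] at this
    linear_combination this
  intro h
  have hw := aw_contDiff hu
  have hwd : Differentiable ℝ (aw u) := hw.differentiable (by norm_num)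
  have hud : Differentiable ℝ u := hu.differentiable (by norm_num)
  obtain ⟨hp, hQ⟩ := (inER_iff hR hq).1 hE
  have hgf : ContDiff ℝ 1 gf := by
    have h1 : ContDiff ℝ 1 (fun z : ℝ × ℝ => (z.1 : ℂ)) := Complex.ofRealCLM.contDiff.comp contDiff_fst
    have h2 : ContDiff ℝ 1 (fun z : ℝ × ℝ => (z.2 : ℂ)) := Complex.ofRealCLM.contDiff.comp contDiff_snd
    exact (((contDiff_const.mul h1).mul h2).div_const 2).neg.cexp
  have cv : ContDiff ℝ 1 (gv u) := hgf.mul (hu.of_le (by norm_num))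
  have cW : ContDiff ℝ 1 (gv (aw u)) := hgf.mul hw
  have eW : ∀ z, gv (aw u) z = gV1 u z + Complex.I * gV2 u z := by
    intro z; simp only [gv, aw, gV1, gV2]; ring
  have W2 : QP R (gv (aw u)) := by
    intro x y
    rw [eW, eW, (V_QP hud hQ).1, (V_QP hud hQ).2]; ring
  have W1 : ∀ x y, gv (aw u) (x + R, y) = gv (aw u) (x, y) := by
    intro x y
    have key : fderiv ℝ (gv u) ((x, y) + (R, 0)) = fderiv ℝ (gv u) (x, y) := by
      rw [← fderiv_comp_add_right]
      congr 1
      funext z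
      have hz : z + (R, 0) = (z.1 + R, z.2) := by ext <;> simp
      rw [hz, hp]
    simp only [Prod.mk_add_mk, add_zero] at key
    have a1 := (gv_fderiv hud (x + R, y)).1
    have a2 := (gv_fderiv hud (x + R, y)).2
    rw [key, (gv_fderiv hud (x, y)).1, hp] at a1
    rw [key, (gv_fderiv hud (x, y)).2] at a2
    rw [eW, eW, ← a2]
    simp only at a1
    linear_combination -a1
  set p : ℝ × ℝ → ℂ := fun z => (starRingEnd ℂ) (gv u z) * gv (aw u) z with hpdef
  have cp : ContDiff ℝ 1 p := ((Complex.conjCLE : ℂ →L[ℝ] ℂ).contDiff.comp cv).mul cW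
  have ph : ∀ x : ℝ, (starRingEnd ℂ) (Complex.exp (-(Complex.I * R * x))) * Complex.exp (-(Complex.I * R * x)) = 1 := by
    intro x
    rw [Complex.conj_mul', show -(Complex.I * R * x) = ((-(R * x) : ℝ) : ℂ) * Complex.I by push_cast; ring,
      Complex.norm_exp_ofReal_mul_I]; simp
  have I1 := per_int1 hR cp (fun x y => by simp only [hpdef]; rw [hp, W1])
  have I2 := per_int2 hR cp (fun x y => by
    simp only [hpdef]; rw [hQ, W2, map_mul]
    linear_combination ((starRingEnd ℂ) (gv u (x, y)) * gv (aw u) (x, y)) * ph x)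
  have id : ∀ z, ((‖gv (aw u) z‖ ^ 2 : ℝ) : ℂ) = fderiv ℝ p z (1, 0) - Complex.I * fderiv ℝ p z (0, 1) := by
    intro z
    have hpz : HasFDerivAt p _ z :=
      (conj_hasFDerivAt (gv_diff hud z).hasFDerivAt).mul (gv_diff hwd z).hasFDerivAt
    rw [hpz.fderiv]
    have w1 := (gv_fderiv hwd z).1
    have w2 := (gv_fderiv hwd z).2
    have v1 := (gv_fderiv hud z).1
    have v2 := (gv_fderiv hud z).2
    have eq : gV1 (aw u) z - Complex.I * gV2 (aw u) z = 0 := by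
      have := comm_id hu z
      rw [← h z] at this
      simp only [gV1, gV2]
      linear_combination gf z * this
    have nm : ((‖gv (aw u) z‖ ^ 2 : ℝ) : ℂ) = (starRingEnd ℂ) (gV1 u z + Complex.I * gV2 u z) * gv (aw u) z := by
      rw [← eW, Complex.conj_mul']; push_cast; rfl
    rw [nm]
    simp [v1, v2, w1, w2]
    linear_combination (-(starRingEnd ℂ) (gv u z)) * eq
  have hz := zero_of_int hR (gv_diff hwd).continuous (fun x y => by rw [W1]) (fun x y => by
    rw [W2, norm_mul, show -(Complex.I * R * x) = ((-(R * x) : ℝ) : ℂ) * Complex.I by push_cast; ring,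
      Complex.norm_exp_ofReal_mul_I, one_mul]) (by
    have c1 : Continuous (fun z => fderiv ℝ p z (1, 0)) := (cp.continuous_fderiv (by norm_num)).clm_apply continuous_const
    have c2 : Continuous (fun z => fderiv ℝ p z (0, 1)) := (cp.continuous_fderiv (by norm_num)).clm_apply continuous_const
    have : ((∫ z in KR R, ‖gv (aw u) z‖ ^ 2 : ℝ) : ℂ) = 0 := by
      rw [← integral_complex_ofReal]
      simp_rw [id]
      rw [integral_sub (cont_int_KR c1) ((cont_int_KR c2).const_mul _), integral_const_mul, I1, I2]
      simp
    exact_mod_cast this)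
  intro z
  have := hz z
  rw [← norm_eq_zero, gv_norm, norm_eq_zero] at this
  exact this

/-- spectral properties of the periodic Landau operator
`P_R = -(∇ - iA₀)²` under the quantization `R² = 2πN`: the lowest eigenvalue is `1`
(the form is `≥ ‖·‖²` and the value `1` is attained), the second distinct eigenvalue
is `≥ 3` (gap on the orthogonal complement of the ground space), the ground space
`ker(P_R - 1)` has complex dimension `N`, and `ker(P_R - 1)` coincides with the space
of magnetic-periodic solutions of `(∂₁ + i∂₂ + ½(x₁+ix₂))u = 0`. -/
theorem stmt16 (R : ℝ) (N : ℕ) (hN : 0 < N) (hR : 0 < R)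
    (hquant : R ^ 2 = 2 * Real.pi * N) :
    -- `μ₁(P_R) = 1`
    ((∀ f : ℝ × ℝ → ℂ, Differentiable ℝ f → inER R N f →
        IntegrableOn (fun x => ‖f x‖ ^ 2) (KR R) →
        IntegrableOn (fun x => ‖mg1 f x‖ ^ 2 + ‖mg2 f x‖ ^ 2) (KR R) →
        (∫ x in KR R, ‖f x‖ ^ 2) ≤ QR R f) ∧
      (∃ u : ℝ × ℝ → ℂ, groundState R N u ∧ u ≠ 0)) ∧
    -- `μ₂(P_R) ≥ 3`
    (∀ f : ℝ × ℝ → ℂ, Differentiable ℝ f → inER R N f →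
        IntegrableOn (fun x => ‖f x‖ ^ 2) (KR R) →
        IntegrableOn (fun x => ‖mg1 f x‖ ^ 2 + ‖mg2 f x‖ ^ 2) (KR R) →
        (∀ v : ℝ × ℝ → ℂ, groundState R N v →
          (∫ x in KR R, (starRingEnd ℂ) (v x) * f x) = 0) →
        3 * ∫ x in KR R, ‖f x‖ ^ 2 ≤ QR R f) ∧
    -- `dim ker(P_R - 1) = N = |K_R|/(2π)`
    (∃ b : Fin N → (ℝ × ℝ → ℂ), (∀ i, groundState R N (b i)) ∧
        LinearIndependent ℂ b ∧
        ∀ u : ℝ × ℝ → ℂ, groundState R N u → ∃ c : Fin N → ℂ, u = ∑ i, c i • b i) ∧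
    -- `ker(P_R - 1) = {u ∈ E_R : (∂₁ + i∂₂ + ½(x₁+ix₂))u = 0}`
    (∀ u : ℝ × ℝ → ℂ, ContDiff ℝ 2 u → inER R N u →
        ((∀ x : ℝ × ℝ, -magLap u x = u x) ↔ annihilated u)) := by
  refine ⟨⟨fun f hf hE h0 hi => (main_ineq hN hR hquant hf hE h0 hi).1, thU R N ⟨0, hN⟩,
      thU_ground hN hR hquant _, thU_ne hN hR _⟩,
    fun f hf hE h0 hi ho => (main_ineq hN hR hquant hf hE h0 hi).2 (orth_part hN hR hquant hf hE ho),
    ⟨thU R N, thU_ground hN hR hquant, (dim_part hN hR hquant).1, (dim_part hN hR hquant).2⟩,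
    fun u hu hE => last_part hR hquant hu hE⟩
end
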